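/- Let the cost function be linear, c(ρ) = 1 + α·ρ with α ≥ 0, and assume v satisfies (H2'): v : [0,ρ_max] → [0,v_max] is C², strictly decreasing, v(0) = v_max > 0, v(ρ_max) = 0, and v'(ρ) + ρ·v''(ρ) ≤ 0 for all ρ ∈ [0,ρ_max]. Then for every measurable initial datum ρ̄ : (−1,1) → [0,ρ_max] there exists an entropy solution (ρ,ξ) of Hughes' model with initial datum ρ̄ defined globally in time. -/

import Mathlib

open MeasureTheory Set Filter

noncomputable section

/-- The flux `f(ρ) = ρ·v(ρ)`. -/
def hughesFlux (v : ℝ → ℝ) (r : ℝ) : ℝ := r * v r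

/-- The discontinuous flux `F(t,x,ρ,ξ) = sign(x − ξ(t))·f(ρ)`. -/
def hughesF (v : ℝ → ℝ) (ξ : ℝ → ℝ) (t x r : ℝ) : ℝ :=
  Real.sign (x - ξ t) * hughesFlux v r

/-- The Kruzhkov-type entropy flux `𝓕(t,x,ρ,k,ξ)`. -/
def hughesKruzhkov (v : ℝ → ℝ) (ξ : ℝ → ℝ) (t x r k : ℝ) : ℝ :=
  Real.sign (r - k) * (hughesF v ξ t x r - hughesF v ξ t x k)

/-- Entropy solution of Hughes' model on `C = (−1,1)` with speed `v`, cost `c`,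
maximal density `ρmax` and initial datum `ρ₀` (extended by `0` outside `C`). -/
structure IsEntropySol (ρmax : ℝ) (v c : ℝ → ℝ) (ρ₀ : ℝ → ℝ)
    (ρ : ℝ → ℝ → ℝ) (ξ : ℝ → ℝ) : Prop where
  meas : Measurable (Function.uncurry ρ)
  range : ∀ t x : ℝ, 0 ≤ t → ρ t x ∈ Icc 0 ρmax
  integrable : ∀ t : ℝ, 0 ≤ t → Integrable (ρ t)
  timeCont : ∀ s : ℝ, 0 ≤ s →
    Tendsto (fun t => ∫ x : ℝ, |ρ t x - ρ s x|) (nhdsWithin s (Ici 0)) (nhds 0)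
  init : ∀ᵐ x : ℝ, ρ 0 x = if x ∈ Ioo (-1 : ℝ) 1 then ρ₀ x else 0
  xi_mem : ∀ t : ℝ, ξ t ∈ Ioo (-1 : ℝ) 1
  xi_lip : ∃ L : NNReal, LipschitzOnWith L ξ (Ici 0)
  balance : ∀ᵐ t ∂(volume.restrict (Ioi (0 : ℝ))),
    ∫ y in Ioo (-1 : ℝ) (ξ t), c (ρ t y) = ∫ y in Ioo (ξ t) 1, c (ρ t y)
  entropy : ∀ k ∈ Icc (0 : ℝ) ρmax, ∀ φ : ℝ × ℝ → ℝ,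
    ContDiff ℝ (⊤ : ℕ∞) φ → HasCompactSupport φ →
    (∀ p : ℝ × ℝ, p.1 ≤ 0 → φ p = 0) → (∀ p : ℝ × ℝ, 0 ≤ φ p) →
    0 ≤ (∫ t in Ioi (0 : ℝ), ∫ x : ℝ,
          (|ρ t x - k| * (fderiv ℝ φ (t, x)) (1, 0)
            + hughesKruzhkov v ξ t x (ρ t x) k * (fderiv ℝ φ (t, x)) (0, 1)))
        + 2 * ∫ t in Ioi (0 : ℝ), hughesFlux v k * φ (t, ξ t)

/-- BV-regular entropy solution: in addition `ρ ∈ L^∞([0,T]; BV((−1,1)))` for all `T > 0`. -/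
def IsBVEntropySol (ρmax : ℝ) (v c : ℝ → ℝ) (ρ₀ : ℝ → ℝ)
    (ρ : ℝ → ℝ → ℝ) (ξ : ℝ → ℝ) : Prop :=
  IsEntropySol ρmax v c ρ₀ ρ ξ ∧
    ∀ T > (0 : ℝ), ∃ V : ENNReal, V < ⊤ ∧
      ∀ t ∈ Icc (0 : ℝ) T, eVariationOn (ρ t) (Ioo (-1 : ℝ) 1) ≤ V

/-- Assumption (H2') on the speed map, with explicit first and second derivatives
`v'`, `v''` on `[0, ρmax]`: `v` is C², strictly decreasing from `v(0) = vmax > 0`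
to `v(ρmax) = 0`, valued in `[0, vmax]`, and `v'(ρ) + ρ·v''(ρ) ≤ 0` on `[0, ρmax]`. -/
structure SpeedH2' (ρmax vmax : ℝ) (v v' v'' : ℝ → ℝ) : Prop where
  vmax_pos : 0 < vmax
  hasDeriv : ∀ x ∈ Icc (0 : ℝ) ρmax, HasDerivWithinAt v (v' x) (Icc 0 ρmax) x
  hasDeriv2 : ∀ x ∈ Icc (0 : ℝ) ρmax, HasDerivWithinAt v' (v'' x) (Icc 0 ρmax) x
  cont2 : ContinuousOn v'' (Icc 0 ρmax)
  anti : StrictAntiOn v (Icc 0 ρmax)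
  range : ∀ x ∈ Icc (0 : ℝ) ρmax, v x ∈ Icc 0 vmax
  at_zero : v 0 = vmax
  at_max : v ρmax = 0
  degenerate : ∀ x ∈ Icc (0 : ℝ) ρmax, v' x + x * v'' x ≤ 0

section Development

namespace Hughes

open scoped Topology NNReal

/-- A concave flux `f` on `[0, R]` vanishing at both ends, with its Legendre transform `g`, the
maximizer `P` of `p ↦ f p - q * p`, a bound `M` on the wave speeds, and a modulus of continuity
`δ` of `P`. -/
structure LegendreData (R M : ℝ) (f g P δ : ℝ → ℝ) : Prop where
  R_pos : 0 < R
  M_pos : 0 < M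
  f_cont : ContinuousOn f (Icc 0 R)
  f_zero : f 0 = 0
  f_R : f R = 0
  P_mem : ∀ q, P q ∈ Icc 0 R
  le_g : ∀ q, ∀ p ∈ Icc 0 R, f p - q * p ≤ g q
  g_eq : ∀ q, g q = f (P q) - q * P q
  exists_dual : ∀ r ∈ Icc 0 R, ∃ q ∈ Icc (-M) M, g q ≤ f r - q * r
  g_of_ge : ∀ q, M ≤ q → g q = 0
  g_of_le : ∀ q, q ≤ -M → g q = -q * R
  δ_pos : ∀ ε > 0, 0 < δ ε
  δ_le : ∀ ε, δ ε ≤ 1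
  δ_spec : ∀ ε > 0, ∀ q q', |q' - q| ≤ δ ε → |P q' - P q| ≤ ε

lemma exists_midpoint_gap {R ε : ℝ} {f : ℝ → ℝ} (hc : ContinuousOn f (Icc 0 R))
    (hf : StrictConcaveOn ℝ (Icc 0 R) f) (hε : 0 < ε) :
    ∃ η > 0, ∀ p ∈ Icc 0 R, ∀ p' ∈ Icc 0 R, ε ≤ |p' - p| →
      η ≤ 2 * f ((p + p') / 2) - f p - f p' := by
  set K : Set (ℝ × ℝ) := (Icc 0 R ×ˢ Icc 0 R) ∩ {z | ε ≤ |z.2 - z.1|} with hK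
  have hKc : IsCompact K := (isCompact_Icc.prod isCompact_Icc).inter_right
    (isClosed_le continuous_const (by fun_prop))
  set Φ : ℝ × ℝ → ℝ := fun z => 2 * f ((z.1 + z.2) / 2) - f z.1 - f z.2 with hΦ
  have hmid : ∀ z ∈ K, (z.1 + z.2) / 2 ∈ Icc 0 R := by
    rintro ⟨a, b⟩ ⟨⟨ha, hb⟩, -⟩
    simp only [mem_Icc] at ha hb ⊢
    constructor <;> linarith
  have hΦc : ContinuousOn Φ K := by
    refine ((continuousOn_const.mul (hc.comp (by fun_prop) hmid)).sub
      (hc.comp continuousOn_fst fun z hz => hz.1.1)).sub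
        (hc.comp continuousOn_snd fun z hz => hz.1.2)
  rcases K.eq_empty_or_nonempty with h | h
  · refine ⟨1, one_pos, fun p hp p' hp' hpp => ?_⟩
    have : (p, p') ∈ K := ⟨⟨hp, hp'⟩, hpp⟩
    simp [h] at this
  · obtain ⟨z, hz, hmin⟩ := hKc.exists_isMinOn h hΦc
    refine ⟨Φ z, ?_, fun p hp p' hp' hpp => hmin (show (p, p') ∈ K from ⟨⟨hp, hp'⟩, hpp⟩)⟩
    have hne : z.1 ≠ z.2 := by
      intro he
      have := hz.2
      simp only [mem_ofPred_eq, he, sub_self, abs_zero] at this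
      linarith
    have := hf.2 hz.1.1 hz.1.2 hne (show (0 : ℝ) < 1 / 2 by norm_num)
      (show (0 : ℝ) < 1 / 2 by norm_num) (by norm_num)
    simp only [smul_eq_mul] at this
    have he : (z.1 + z.2) / 2 = 1 / 2 * z.1 + 1 / 2 * z.2 := by ring
    simp only [hΦ, he]
    linarith

theorem exists_legendreData {ρmax vmax : ℝ} {v v' v'' : ℝ → ℝ} (hρ : 0 < ρmax)
    (hv : SpeedH2' ρmax vmax v v' v'') :
    ∃ M g P δ, LegendreData ρmax M (hughesFlux v) g P δ := by
  set f := hughesFlux v with hf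
  set D : ℝ → ℝ := fun r => v r + r * v' r with hD
  have h0 : (0 : ℝ) ∈ Icc 0 ρmax := ⟨le_rfl, hρ.le⟩
  have hR : ρmax ∈ Icc 0 ρmax := ⟨hρ.le, le_rfl⟩
  have hd : ∀ x ∈ Icc 0 ρmax, HasDerivWithinAt f (D x) (Icc 0 ρmax) x := fun x hx => by
    have := (hasDerivWithinAt_id x (Icc 0 ρmax)).mul (hv.hasDeriv x hx)
    change HasDerivWithinAt (fun r => r * v r) (v x + x * v' x) _ _
    simpa [Pi.mul_def] using this
  have hc : ContinuousOn f (Icc 0 ρmax) := fun x hx => (hd x hx).continuousWithinAt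
  have hanti' : AntitoneOn (fun r => r * v' r) (Icc 0 ρmax) := by
    have hd2 : ∀ x ∈ Icc 0 ρmax,
        HasDerivWithinAt (fun r => r * v' r) (v' x + x * v'' x) (Icc 0 ρmax) x := fun x hx => by
      have := (hasDerivWithinAt_id x (Icc 0 ρmax)).mul (hv.hasDeriv2 x hx)
      simpa [Pi.mul_def] using this
    exact antitoneOn_of_hasDerivWithinAt_nonpos (convex_Icc _ _)
      (fun x hx => (hd2 x hx).continuousWithinAt)
      (fun x hx => (hd2 x (interior_subset hx)).mono interior_subset)
      (fun x hx => hv.degenerate x (interior_subset hx))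
  have hanti : StrictAntiOn D (Icc 0 ρmax) := fun a ha b hb hab =>
    add_lt_add_of_lt_of_le (hv.anti ha hb hab) (hanti' ha hb hab.le)
  have hda : ∀ x ∈ Ioo 0 ρmax, HasDerivAt f (D x) x := fun x hx =>
    (hd x (Ioo_subset_Icc_self hx)).hasDerivAt (Icc_mem_nhds hx.1 hx.2)
  have hconc : StrictConcaveOn ℝ (Icc 0 ρmax) f := by
    refine StrictAntiOn.strictConcaveOn_of_deriv (convex_Icc _ _) hc ?_
    rw [interior_Icc]
    intro a ha b hb hab
    rw [(hda a ha).deriv, (hda b hb).deriv]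
    exact hanti (Ioo_subset_Icc_self ha) (Ioo_subset_Icc_self hb) hab
  have htan : ∀ r ∈ Icc 0 ρmax, ∀ p ∈ Icc 0 ρmax, f p ≤ f r + D r * (p - r) := by
    intro r hr p hp
    rcases lt_trichotomy r p with h | h | h
    · obtain ⟨c, hc1, hc2⟩ := exists_hasDerivAt_eq_slope f D h
        (hc.mono (Icc_subset_Icc hr.1 hp.2))
        (fun x hx => hda x ⟨hr.1.trans_lt hx.1, hx.2.trans_le hp.2⟩)
      have hcD := hanti hr ⟨hr.1.trans hc1.1.le, hc1.2.le.trans hp.2⟩ hc1.1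
      rw [eq_div_iff (by linarith)] at hc2
      nlinarith [mul_le_mul_of_nonneg_right hcD.le (sub_nonneg.2 h.le)]
    · subst h; simp
    · obtain ⟨c, hc1, hc2⟩ := exists_hasDerivAt_eq_slope f D h
        (hc.mono (Icc_subset_Icc hp.1 hr.2))
        (fun x hx => hda x ⟨hp.1.trans_lt hx.1, hx.2.trans_le hr.2⟩)
      have hcD := hanti ⟨hp.1.trans hc1.1.le, hc1.2.le.trans hr.2⟩ hr hc1.2
      rw [eq_div_iff (by linarith)] at hc2
      nlinarith [mul_le_mul_of_nonneg_right hcD.le (sub_nonneg.2 h.le)]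
  have hf0 : f 0 = 0 := by simp [hf, hughesFlux]
  have hfR : f ρmax = 0 := by simp [hf, hughesFlux, hv.at_max]
  set M : ℝ := |D 0| + |D ρmax| + 1 with hM
  have hMpos : 0 < M := by positivity
  have hDM : ∀ r ∈ Icc 0 ρmax, D r ∈ Icc (-M) M := fun r hr => by
    have h1 := hanti.antitoneOn h0 hr hr.1
    have h2 := hanti.antitoneOn hr hR hr.2
    have h3 := le_abs_self (D 0)
    have h4 := neg_abs_le (D ρmax)
    have h5 := abs_nonneg (D 0)
    have h6 := abs_nonneg (D ρmax)
    constructor <;> linarith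
  have hP : ∀ q : ℝ, ∃ p ∈ Icc 0 ρmax, ∀ p' ∈ Icc 0 ρmax, f p' - q * p' ≤ f p - q * p := by
    intro q
    obtain ⟨p, hp, hmax⟩ := isCompact_Icc.exists_isMaxOn ⟨0, h0⟩
      (hc.sub (continuousOn_const.mul continuousOn_id) :
        ContinuousOn (fun p => f p - q * p) (Icc 0 ρmax))
    exact ⟨p, hp, fun p' hp' => hmax hp'⟩
  choose P hPm hPmax using hP
  have huc : ∀ ε : ℝ, ∃ d : ℝ, d ≤ 1 ∧ (0 < ε → 0 < d ∧
      ∀ q q', |q' - q| ≤ d → |P q' - P q| ≤ ε) := by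
    intro ε
    by_cases hε : 0 < ε
    · obtain ⟨η, hη, hgap⟩ := exists_midpoint_gap hc hconc hε
      refine ⟨min 1 (η / ρmax), min_le_left _ _, fun _ => ⟨by positivity, fun q q' hq => ?_⟩⟩
      by_contra! hcon
      have h1 := hgap (P q) (hPm q) (P q') (hPm q') hcon.le
      have hm : (P q + P q') / 2 ∈ Icc 0 ρmax := by
        have := hPm q
        have := hPm q'
        simp only [mem_Icc] at *
        constructor <;> linarith
      have h2 := hPmax q _ hm
      have h3 := hPmax q' _ hm
      have h4 : η ≤ (q - q') * (P q' - P q) / 2 := by linarith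
      have h5 : |P q' - P q| ≤ ρmax := by
        have := hPm q
        have := hPm q'
        simp only [mem_Icc] at *
        rw [abs_le]; constructor <;> linarith
      have h6 : (q - q') * (P q' - P q) ≤ |q' - q| * |P q' - P q| := by
        rw [abs_sub_comm q' q, ← abs_mul]; exact le_abs_self _
      have h7 : |q' - q| * |P q' - P q| ≤ (η / ρmax) * ρmax :=
        mul_le_mul (hq.trans (min_le_right _ _)) h5 (abs_nonneg _) (by positivity)
      rw [div_mul_cancel₀ _ hρ.ne'] at h7
      linarith
    · exact ⟨1, le_rfl, fun h => absurd h hε⟩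
  choose δ hδ1 hδ using huc
  refine ⟨M, fun q => f (P q) - q * P q, P, δ, hρ, hMpos, hc, hf0, hfR, hPm, hPmax, fun _ => rfl,
    ?_, ?_, ?_, fun ε hε => (hδ ε hε).1, hδ1, fun ε hε => (hδ ε hε).2⟩
  · intro r hr
    refine ⟨D r, hDM r hr, ?_⟩
    have := htan r hr (P (D r)) (hPm _)
    linarith
  · intro q hq
    refine le_antisymm ?_ ?_
    · have := htan 0 h0 (P q) (hPm q)
      have h2 := (hDM 0 h0).2
      have := mul_le_mul_of_nonneg_right (h2.trans hq) (hPm q).1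
      simp only [hf0, sub_zero] at *
      linarith
    · have := hPmax q 0 h0
      simpa [hf0] using this
  · intro q hq
    refine le_antisymm ?_ ?_
    · have := htan ρmax hR (P q) (hPm q)
      have h2 := (hDM ρmax hR).1
      have := mul_le_mul_of_nonneg_right (hq.trans h2) (sub_nonneg.2 (hPm q).2)
      simp only [hfR] at *
      linarith
    · have := hPmax q ρmax hR
      simp only [hfR] at this
      linarith

namespace LegendreData

variable {R M : ℝ} {f g P δ : ℝ → ℝ}

lemma zero_mem (H : LegendreData R M f g P δ) : (0 : ℝ) ∈ Icc 0 R := ⟨le_rfl, H.R_pos.le⟩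

lemma R_mem (H : LegendreData R M f g P δ) : R ∈ Icc 0 R := ⟨H.R_pos.le, le_rfl⟩

lemma g_nonneg (H : LegendreData R M f g P δ) (q : ℝ) : 0 ≤ g q := by
  simpa [H.f_zero] using H.le_g q 0 H.zero_mem

lemma neg_mul_le_g (H : LegendreData R M f g P δ) (q : ℝ) : -q * R ≤ g q := by
  have := H.le_g q R H.R_mem
  rw [H.f_R] at this
  linarith

lemma g_sub_le (H : LegendreData R M f g P δ) (q q' : ℝ) : g q - P q * (q' - q) ≤ g q' := by
  have := H.le_g q' (P q) (H.P_mem q)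
  rw [H.g_eq q]
  linarith

lemma g_antitone (H : LegendreData R M f g P δ) : Antitone g := fun q q' h => by
  have h1 := H.g_sub_le q' q
  have := mul_nonneg (H.P_mem q').1 (sub_nonneg.2 h)
  linarith

lemma g_le_add (H : LegendreData R M f g P δ) {q q' : ℝ} (h : q ≤ q') :
    g q ≤ g q' + R * (q' - q) := by
  have h1 := H.g_sub_le q q'
  have := mul_le_mul_of_nonneg_right (H.P_mem q).2 (sub_nonneg.2 h)
  linarith

lemma g_continuous (H : LegendreData R M f g P δ) : Continuous g := by
  refine (LipschitzWith.of_le_add_mul (Real.toNNReal R) fun q q' => ?_).continuous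
  rw [Real.coe_toNNReal _ H.R_pos.le, Real.dist_eq]
  rcases le_total q q' with h | h
  · have := H.g_le_add h
    rwa [abs_sub_comm, abs_of_nonneg (sub_nonneg.2 h)]
  · have := H.g_antitone h
    have := mul_nonneg H.R_pos.le (abs_nonneg (q - q'))
    linarith

lemma g_le_modulus (H : LegendreData R M f g P δ) {ε q q' : ℝ} (hε : 0 < ε)
    (h : |q' - q| ≤ δ ε) : g q' ≤ g q - P q * (q' - q) + ε * |q' - q| := by
  have h1 := H.g_sub_le q' q
  have h2 := H.δ_spec ε hε q q' h
  have h3 : (P q - P q') * (q' - q) ≤ |P q' - P q| * |q' - q| := by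
    rw [abs_sub_comm (P q'), ← abs_mul]; exact le_abs_self _
  have h4 := mul_le_mul_of_nonneg_right h2 (abs_nonneg (q' - q))
  linarith

lemma g_perspective (H : LegendreData R M f g P δ) {a b s t : ℝ} (ha : 0 ≤ a) (hb : 0 < b)
    (hs : a = 0 → s = 0) :
    (a + b) * g ((s + t) / (a + b)) ≤ a * g (s / a) + b * g (t / b) := by
  have hab : 0 < a + b := by linarith
  set Q := (s + t) / (a + b) with hQ
  have hQe : (a + b) * Q = s + t := by rw [hQ]; field_simp
  have h1 : a * f (P Q) - s * P Q ≤ a * g (s / a) := by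
    rcases ha.eq_or_lt with h0 | h0
    · simp [← h0, hs h0.symm]
    · have := mul_le_mul_of_nonneg_left (H.le_g (s / a) (P Q) (H.P_mem Q)) ha
      have e : a * (f (P Q) - s / a * P Q) = a * f (P Q) - s * P Q := by field_simp
      linarith
  have h2 : b * f (P Q) - t * P Q ≤ b * g (t / b) := by
    have := mul_le_mul_of_nonneg_left (H.le_g (t / b) (P Q) (H.P_mem Q)) hb.le
    have e : b * (f (P Q) - t / b * P Q) = b * f (P Q) - t * P Q := by field_simp
    linarith
  rw [H.g_eq Q, mul_sub, ← mul_assoc, hQe]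
  linarith

lemma g_four_point (H : LegendreData R M f g P δ) {q₁ q₂ a b : ℝ} (h1 : q₁ ≤ a) (h2 : a ≤ q₂)
    (hab : a + b = q₁ + q₂) : g a + g b ≤ g q₁ + g q₂ := by
  rcases eq_or_lt_of_le (h1.trans h2) with h | h
  · have ha : a = q₁ := by linarith
    have hb : b = q₂ := by linarith
    rw [ha, hb]
  · have key : ∀ x, q₁ ≤ x → x ≤ q₂ →
        (q₂ - q₁) * g x ≤ (q₂ - x) * g q₁ + (x - q₁) * g q₂ := by
      intro x hx1 hx2
      have e1 := mul_le_mul_of_nonneg_left (H.g_sub_le x q₁) (sub_nonneg.2 hx2)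
      have e2 := mul_le_mul_of_nonneg_left (H.g_sub_le x q₂) (sub_nonneg.2 hx1)
      nlinarith
    have k1 := key a h1 h2
    have k2 := key b (by linarith) (by linarith)
    have hb : b = q₁ + q₂ - a := by linarith
    have : (q₂ - q₁) * (g a + g b) ≤ (q₂ - q₁) * (g q₁ + g q₂) := by
      rw [hb] at k2 ⊢
      nlinarith
    exact le_of_mul_le_mul_left this (by linarith)

end LegendreData

/-- Nondecreasing functions with slope at most `k`: primitives of densities with values in
`[0, k]`. -/
structure Prim (k : ℝ) (A : ℝ → ℝ) : Prop where
  mono : Monotone A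
  sub_le : ∀ x y, x ≤ y → A y - A x ≤ k * (y - x)

lemma Prim.weaken {k k' : ℝ} {A : ℝ → ℝ} (hA : Prim k A) (h : k ≤ k') : Prim k' A :=
  ⟨hA.mono, fun x y hxy => (hA.sub_le x y hxy).trans
    (mul_le_mul_of_nonneg_right h (sub_nonneg.2 hxy))⟩

lemma Prim.abs_sub_le {k : ℝ} {A : ℝ → ℝ} (hA : Prim k A) (x y : ℝ) :
    |A x - A y| ≤ k * |x - y| := by
  rcases le_total x y with h | h
  · rw [abs_sub_comm, abs_of_nonneg (sub_nonneg.2 (hA.mono h)), abs_sub_comm,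
      abs_of_nonneg (sub_nonneg.2 h)]
    exact hA.sub_le x y h
  · rw [abs_of_nonneg (sub_nonneg.2 (hA.mono h)), abs_of_nonneg (sub_nonneg.2 h)]
    exact hA.sub_le y x h

lemma Prim.lipschitz {k : ℝ} {A : ℝ → ℝ} (hA : Prim k A) :
    LipschitzWith (Real.toNNReal k) A :=
  LipschitzWith.of_dist_le_mul fun x y => by
    rw [Real.dist_eq, Real.dist_eq]
    exact (hA.abs_sub_le x y).trans
      (mul_le_mul_of_nonneg_right (Real.le_coe_toNNReal k) (abs_nonneg _))

lemma Prim.continuous {k : ℝ} {A : ℝ → ℝ} (hA : Prim k A) : Continuous A := hA.lipschitz.continuous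

/-- Freezing the function to the left of `ξ`. -/
def cut (ξ : ℝ) (A : ℝ → ℝ) (y : ℝ) : ℝ := A (max y ξ)

/-- Point reflection. -/
def refl (A : ℝ → ℝ) (y : ℝ) : ℝ := -A (-y)

@[simp] lemma refl_refl (A : ℝ → ℝ) : refl (refl A) = A := by ext; simp [refl]

lemma Prim.cut {k : ℝ} {A : ℝ → ℝ} (hA : Prim k A) (ξ : ℝ) {x y : ℝ} (h : x ≤ y) :
    cut ξ A x ≤ cut ξ A y ∧ cut ξ A y - cut ξ A x ≤ k * (max y ξ - max x ξ) :=
  ⟨hA.mono (max_le_max_right ξ h), hA.sub_le _ _ (max_le_max_right ξ h)⟩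

lemma Prim.cut' {k : ℝ} (hk : 0 ≤ k) {A : ℝ → ℝ} (hA : Prim k A) (ξ : ℝ) :
    Prim k (Hughes.cut ξ A) :=
  ⟨fun _ _ h => (hA.cut ξ h).1, fun x y h => (hA.cut ξ h).2.trans
    (mul_le_mul_of_nonneg_left (by
      rcases le_total x ξ with h1 | h1 <;> rcases le_total y ξ with h2 | h2 <;> simp [h1, h2] <;>
        linarith) hk)⟩

lemma Prim.refl {k : ℝ} {A : ℝ → ℝ} (hA : Prim k A) : Prim k (Hughes.refl A) :=
  ⟨fun x y h => neg_le_neg (hA.mono (neg_le_neg h)), fun x y h => by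
    have := hA.sub_le (-y) (-x) (neg_le_neg h)
    simp only [Hughes.refl]
    linarith⟩

/-- One step of size `h` of the Hopf–Lax semigroup. -/
def hopf (M : ℝ) (g : ℝ → ℝ) (h : ℝ) (A : ℝ → ℝ) (x : ℝ) : ℝ :=
  ⨆ q : Icc (-M) M, (A (x - h * q) - h * g q)

/-- The Hopf–Lax step to the right of the interface `ξ`. -/
def rightOp (M : ℝ) (g : ℝ → ℝ) (h ξ : ℝ) (A : ℝ → ℝ) (x : ℝ) : ℝ := hopf M g h (cut ξ A) x

/-- One time step with the interface frozen at `ξ`: mass to the right of `ξ` moves to the right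
and mass to the left of `ξ` moves to the left. -/
def step (M : ℝ) (g : ℝ → ℝ) (h ξ : ℝ) (A : ℝ → ℝ) (x : ℝ) : ℝ :=
  rightOp M g h ξ A x - rightOp M g h (-ξ) (refl A) (-x) - A ξ

lemma step_refl (M : ℝ) (g : ℝ → ℝ) (h ξ : ℝ) (A : ℝ → ℝ) :
    step M g h (-ξ) (refl A) = refl (step M g h ξ A) := by
  ext x
  simp only [step, refl_refl, neg_neg, refl]
  ring

namespace LegendreData

variable {R M h ξ k : ℝ} {f g P δ A B : ℝ → ℝ}

lemma hopf_bdd (H : LegendreData R M f g P δ) (hA : Continuous A) (x : ℝ) :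
    BddAbove (range fun q : Icc (-M) M => A (x - h * q) - h * g q) := by
  have := H.g_continuous
  exact (isCompact_range (by fun_prop)).bddAbove

lemma hopf_attained (H : LegendreData R M f g P δ) (hA : Continuous A) (x : ℝ) :
    ∃ q ∈ Icc (-M) M, hopf M g h A x = A (x - h * q) - h * g q := by
  have hg := H.g_continuous
  obtain ⟨q, hq, hmax⟩ := (isCompact_Icc (a := -M) (b := M)).exists_isMaxOn
    ⟨0, by constructor <;> linarith [H.M_pos]⟩
    (show ContinuousOn (fun q => A (x - h * q) - h * g q) _ by fun_prop)
  have : Nonempty (Icc (-M) M) := ⟨⟨q, hq⟩⟩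
  exact ⟨q, hq, le_antisymm (ciSup_le fun r => hmax r.2) (le_ciSup (H.hopf_bdd hA x) ⟨q, hq⟩)⟩

lemma le_hopf_of_mem (H : LegendreData R M f g P δ) (hA : Continuous A) (x : ℝ) {q : ℝ}
    (hq : q ∈ Icc (-M) M) : A (x - h * q) - h * g q ≤ hopf M g h A x :=
  le_ciSup (H.hopf_bdd hA x) (⟨q, hq⟩ : Icc (-M) M)

lemma le_hopf (H : LegendreData R M f g P δ) (hh : 0 ≤ h) (hA : Prim R A) (x q : ℝ) :
    A (x - h * q) - h * g q ≤ hopf M g h A x := by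
  have hM := H.M_pos
  rcases le_total q (-M) with h1 | h1
  · refine le_trans ?_ (H.le_hopf_of_mem hA.continuous x (q := -M) ⟨le_rfl, by linarith⟩)
    have hm : h * q ≤ h * -M := mul_le_mul_of_nonneg_left h1 hh
    have := hA.sub_le (x - h * -M) (x - h * q) (by linarith)
    rw [H.g_of_le q h1, H.g_of_le (-M) le_rfl]
    linarith
  · rcases le_total q M with h2 | h2
    · exact H.le_hopf_of_mem hA.continuous x ⟨h1, h2⟩
    · refine le_trans ?_ (H.le_hopf_of_mem hA.continuous x (q := M) ⟨by linarith, le_rfl⟩)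
      have hm : h * M ≤ h * q := mul_le_mul_of_nonneg_left h2 hh
      have := hA.mono (show x - h * q ≤ x - h * M by linarith)
      rw [H.g_of_ge q h2, H.g_of_ge M le_rfl]
      linarith

lemma hopf_order (H : LegendreData R M f g P δ) (hh : 0 < h) (hA : Prim R A) (hB : Prim R B)
    (hAB : Monotone fun x => B x - A x) :
    Monotone fun x => hopf M g h B x - hopf M g h A x := by
  intro x x' hx
  obtain ⟨q₁, -, e1⟩ := H.hopf_attained (h := h) hB.continuous x
  obtain ⟨q₂, -, e2⟩ := H.hopf_attained (h := h) hA.continuous x'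
  rcases le_total (x - h * q₁) (x' - h * q₂) with hc | hc
  · have h1 := H.le_hopf hh.le hA x q₁
    have h2 := H.le_hopf hh.le hB x' q₂
    have h3 := hAB hc
    simp only at h3 ⊢
    linarith
  · have h1 := H.le_hopf hh.le hA x ((x - (x' - h * q₂)) / h)
    have h2 := H.le_hopf hh.le hB x' ((x' - (x - h * q₁)) / h)
    have e3 : x - h * ((x - (x' - h * q₂)) / h) = x' - h * q₂ := by field_simp; ring
    have e4 : x' - h * ((x' - (x - h * q₁)) / h) = x - h * q₁ := by field_simp; ring
    rw [e3] at h1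
    rw [e4] at h2
    have h4 : g ((x - (x' - h * q₂)) / h) + g ((x' - (x - h * q₁)) / h) ≤ g q₁ + g q₂ := by
      refine H.g_four_point ?_ ?_ ?_
      · rw [le_div_iff₀ hh]; linarith
      · rw [div_le_iff₀ hh]; linarith
      · field_simp; ring
    have := mul_le_mul_of_nonneg_left h4 hh.le
    simp only
    linarith

lemma le_rightOp (H : LegendreData R M f g P δ) (hh : 0 ≤ h) (hA : Prim R A) (x q : ℝ) :
    A (x - h * q) - h * g q ≤ rightOp M g h ξ A x :=
  le_trans (sub_le_sub_right (hA.mono (le_max_left _ _)) _)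
    (H.le_hopf hh (hA.cut' H.R_pos.le ξ) x q)

lemma rightOp_attained (H : LegendreData R M f g P δ) (hA : Prim R A) (ξ x : ℝ) :
    ∃ q ∈ Icc (-M) M, rightOp M g h ξ A x = A (max (x - h * q) ξ) - h * g q :=
  H.hopf_attained (hA.cut' H.R_pos.le ξ).continuous x

lemma rightOp_of_le (H : LegendreData R M f g P δ) (hh : 0 ≤ h) (hA : Prim R A) {x : ℝ}
    (hx : x ≤ ξ) : rightOp M g h ξ A x = A ξ := by
  apply le_antisymm
  · obtain ⟨q, hq, e⟩ := H.rightOp_attained (h := h) hA ξ x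
    rw [e]
    rcases le_total (x - h * q) ξ with h1 | h1
    · rw [max_eq_right h1]
      linarith [mul_nonneg hh (H.g_nonneg q)]
    · rw [max_eq_left h1]
      have h2 := hA.sub_le _ _ h1
      have h3 := mul_le_mul_of_nonneg_left (H.neg_mul_le_g q) hh
      have h4 := mul_nonneg H.R_pos.le (sub_nonneg.2 hx)
      nlinarith
  · have h1 := H.le_hopf hh (hA.cut' H.R_pos.le ξ) x M
    have hm : x - h * M ≤ ξ := by linarith [mul_nonneg hh H.M_pos.le]
    rw [H.g_of_ge M le_rfl, cut, max_eq_right hm] at h1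
    simpa [rightOp] using h1

lemma rightOp_bounds (H : LegendreData R M f g P δ) (hh : 0 ≤ h) (hA : Prim R A) {x : ℝ}
    (hx : ξ ≤ x) : A x - h * g 0 ≤ rightOp M g h ξ A x ∧ rightOp M g h ξ A x ≤ A x := by
  constructor
  · simpa using H.le_rightOp (ξ := ξ) hh hA x 0
  · obtain ⟨q, hq, e⟩ := H.rightOp_attained (h := h) hA ξ x
    rw [e]
    rcases le_total 0 q with h1 | h1
    · have := hA.mono (max_le (by linarith [mul_nonneg hh h1]) hx : max (x - h * q) ξ ≤ x)
      linarith [mul_nonneg hh (H.g_nonneg q)]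
    · have h5 := mul_nonneg hh (neg_nonneg.2 h1)
      rw [max_eq_left (by linarith)]
      have h2 := hA.sub_le x (x - h * q) (by linarith)
      have h3 := mul_le_mul_of_nonneg_left (H.neg_mul_le_g q) hh
      nlinarith

lemma rightOp_prim (H : LegendreData R M f g P δ) (hh : 0 < h) (hk : 0 ≤ k) (hkR : k ≤ R)
    (hA : Prim k A) (ξ : ℝ) {x y : ℝ} (hxy : x ≤ y) :
    rightOp M g h ξ A x ≤ rightOp M g h ξ A y ∧
      rightOp M g h ξ A y - rightOp M g h ξ A x ≤ k * (max y ξ - max x ξ) := by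
  have hAR := hA.weaken hkR
  have hlip : ∀ x y, ξ ≤ x → x ≤ y →
      rightOp M g h ξ A y - rightOp M g h ξ A x ≤ k * (y - x) := by
    intro x y _ hxy
    obtain ⟨q, hq, e⟩ := H.hopf_attained (h := h) (hA.cut' hk ξ).continuous y
    have h1 := H.le_hopf hh.le (hAR.cut' H.R_pos.le ξ) x q
    have h2 := (hA.cut' hk ξ).sub_le (x - h * q) (y - h * q) (by linarith)
    simp only [rightOp]
    linarith
  refine ⟨?_, ?_⟩
  · obtain ⟨q, hq, e⟩ := H.hopf_attained (h := h) (hA.cut' hk ξ).continuous x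
    have h1 := H.le_hopf hh.le (hAR.cut' H.R_pos.le ξ) y q
    have h2 := (hA.cut' hk ξ).mono (show x - h * q ≤ y - h * q by linarith)
    simp only [rightOp]
    linarith
  · rcases le_total ξ x with h1 | h1
    · rw [max_eq_left h1, max_eq_left (h1.trans hxy)]
      exact hlip x y h1 hxy
    · rcases le_total ξ y with h2 | h2
      · rw [max_eq_left h2, max_eq_right h1, H.rightOp_of_le hh.le hAR h1,
          ← H.rightOp_of_le hh.le hAR (le_refl ξ)]
        exact hlip ξ y le_rfl h2
      · rw [H.rightOp_of_le hh.le hAR h1, H.rightOp_of_le hh.le hAR h2, max_eq_right h1,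
          max_eq_right h2]
        simp

lemma step_prim (H : LegendreData R M f g P δ) (hh : 0 < h) (hk : 0 ≤ k) (hkR : k ≤ R)
    (hA : Prim k A) (ξ : ℝ) : Prim k (step M g h ξ A) := by
  refine ⟨fun x y hxy => ?_, fun x y hxy => ?_⟩
  · have h1 := (H.rightOp_prim hh hk hkR hA ξ hxy).1
    have h2 := (H.rightOp_prim hh hk hkR hA.refl (-ξ) (neg_le_neg hxy)).1
    simp only [step]
    linarith
  · have h1 := (H.rightOp_prim hh hk hkR hA ξ hxy).2
    have h2 := (H.rightOp_prim hh hk hkR hA.refl (-ξ) (neg_le_neg hxy)).2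
    have e : max y ξ - max x ξ + (max (-x) (-ξ) - max (-y) (-ξ)) = y - x := by
      rw [max_neg_neg, max_neg_neg]
      have := max_add_min y ξ
      have := max_add_min x ξ
      linarith
    have h3 : k * (max y ξ - max x ξ) + k * (max (-x) (-ξ) - max (-y) (-ξ)) = k * (y - x) := by
      rw [← mul_add, e]
    simp only [step]
    linarith

lemma step_order (H : LegendreData R M f g P δ) (hh : 0 < h) (hA : Prim R A) (hB : Prim R B)
    (hAB : Monotone fun x => B x - A x) (ξ : ℝ) :
    Monotone fun x => step M g h ξ B x - step M g h ξ A x := by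
  intro x y hxy
  have hc : Monotone fun x => cut ξ B x - cut ξ A x := fun x y h => hAB (max_le_max_right ξ h)
  have hAB' : Monotone fun x => refl B x - refl A x := fun x y h => by
    have := hAB (neg_le_neg h)
    simp only [refl] at this ⊢
    linarith
  have hc' : Monotone fun x => cut (-ξ) (refl B) x - cut (-ξ) (refl A) x :=
    fun x y h => hAB' (max_le_max_right _ h)
  have h1 := H.hopf_order hh (hA.cut' H.R_pos.le ξ) (hB.cut' H.R_pos.le ξ) hc hxy
  have h2 := H.hopf_order hh (hA.refl.cut' H.R_pos.le (-ξ)) (hB.refl.cut' H.R_pos.le (-ξ)) hc'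
    (neg_le_neg hxy)
  simp only [step, rightOp] at h1 h2 ⊢
  linarith

lemma step_of_ge (H : LegendreData R M f g P δ) (hh : 0 ≤ h) (hA : Prim R A) {x : ℝ}
    (hx : ξ ≤ x) : step M g h ξ A x = rightOp M g h ξ A x := by
  rw [step, H.rightOp_of_le hh hA.refl (neg_le_neg hx)]
  simp [refl]

lemma abs_step_sub_le (H : LegendreData R M f g P δ) (hh : 0 ≤ h) (hA : Prim R A) (ξ x : ℝ) :
    |step M g h ξ A x - A x| ≤ h * g 0 := by
  have key : ∀ {A : ℝ → ℝ} {ξ x : ℝ}, Prim R A → ξ ≤ x →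
      |step M g h ξ A x - A x| ≤ h * g 0 := by
    intro A ξ x hA hx
    obtain ⟨h1, h2⟩ := H.rightOp_bounds hh hA hx
    rw [H.step_of_ge hh hA hx, abs_le]
    constructor <;> linarith [mul_nonneg hh (H.g_nonneg 0)]
  rcases le_total ξ x with hx | hx
  · exact key hA hx
  · have := key hA.refl (neg_le_neg hx)
    rw [step_refl] at this
    simp only [refl, neg_neg] at this
    rwa [abs_sub_comm, neg_sub_neg] at this
 
lemma hopf_sub_const (H : LegendreData R M f g P δ) (hA : Continuous A) (c x : ℝ) :
    hopf M g h (fun y => A y - c) x = hopf M g h A x - c := by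
  obtain ⟨q, hq, e⟩ := H.hopf_attained (h := h) hA x
  obtain ⟨q', hq', e'⟩ := H.hopf_attained (h := h) (hA.sub (continuous_const (y := c))) x
  have h1 := H.le_hopf_of_mem (h := h) hA x hq'
  have h2 := H.le_hopf_of_mem (h := h) (hA.sub (continuous_const (y := c))) x hq
  simp only [Pi.sub_apply] at e' h2
  change hopf M g h (fun y => A y - c) x = _ at e'
  change _ ≤ hopf M g h (fun y => A y - c) x at h2
  apply le_antisymm <;> linarith

lemma step_sub_const (H : LegendreData R M f g P δ) (hA : Prim R A) (ξ c x : ℝ) :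
    step M g h ξ (fun y => A y - c) x = step M g h ξ A x - c := by
  have h1 := H.hopf_sub_const (h := h) (hA.cut' H.R_pos.le ξ).continuous c x
  have h2 := H.hopf_sub_const (h := h) (hA.refl.cut' H.R_pos.le (-ξ)).continuous (-c) (-x)
  have e : (fun y => cut (-ξ) (refl A) y - -c) = cut (-ξ) (refl fun y => A y - c) := by
    ext y; simp only [cut, refl]; ring
  rw [e] at h2
  have e' : (fun y => cut ξ A y - c) = cut ξ fun y => A y - c := rfl
  rw [e'] at h1
  simp only [step, rightOp, h1, h2]
  ring

lemma step_tail (H : LegendreData R M f g P δ) (hh : 0 ≤ h) (hA : Prim R A) {b c : ℝ}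
    (hξ : ξ ≤ b) (hb : ∀ x, b ≤ x → A x = c) {x : ℝ} (hx : b + h * M ≤ x) :
    step M g h ξ A x = c := by
  have hM := mul_nonneg hh H.M_pos.le
  rw [H.step_of_ge hh hA (by linarith)]
  apply le_antisymm
  · rw [← hb x (by linarith)]
    exact (H.rightOp_bounds hh hA (by linarith)).2
  · have := H.le_rightOp (ξ := ξ) hh hA x M
    rw [hb (x - h * M) (by linarith), H.g_of_ge M le_rfl] at this
    linarith

lemma step_consistent (H : LegendreData R M f g P δ) (hh : 0 ≤ h) (hA : Prim R A) {x r η : ℝ}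
    (hr : r ∈ Icc 0 R) (hx : ξ + h * M ≤ x)
    (hη : ∀ q ∈ Icc (-M) M, |A (x - h * q) - A x + h * q * r| ≤ η) :
    |step M g h ξ A x - A x + h * f r| ≤ η := by
  have hM := mul_nonneg hh H.M_pos.le
  rw [H.step_of_ge hh hA (by linarith), abs_le]
  constructor
  · obtain ⟨q, hq, hd⟩ := H.exists_dual r hr
    have h1 := H.le_rightOp (ξ := ξ) hh hA x q
    have h2 := (abs_le.1 (hη q hq)).1
    have h3 := mul_le_mul_of_nonneg_left hd hh
    linarith
  · obtain ⟨q, hq, e⟩ := H.rightOp_attained (h := h) hA ξ x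
    have h2 := (abs_le.1 (hη q hq)).2
    have h3 := mul_le_mul_of_nonneg_left (H.le_g q r hr) hh
    have h4 := mul_le_mul_of_nonneg_left hq.2 hh
    rw [max_eq_left (by linarith)] at e
    linarith

lemma step_consistent_left (H : LegendreData R M f g P δ) (hh : 0 ≤ h) (hA : Prim R A)
    {x r η : ℝ} (hr : r ∈ Icc 0 R) (hx : x ≤ ξ - h * M)
    (hη : ∀ q ∈ Icc (-M) M, |A (x - h * q) - A x + h * q * r| ≤ η) :
    |step M g h ξ A x - A x - h * f r| ≤ η := by
  have := H.step_consistent (ξ := -ξ) (x := -x) (η := η) hh hA.refl hr (by linarith) fun q hq => by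
    have := hη (-q) ⟨neg_le_neg hq.2, by linarith [hq.1]⟩
    simp only [refl, neg_sub, neg_neg, mul_neg, sub_neg_eq_add, neg_mul] at this ⊢
    rw [← abs_neg]
    convert this using 2
    ring_nf
  rw [step_refl] at this
  simp only [refl, neg_neg] at this
  rw [← abs_neg]
  convert this using 2
  ring

end LegendreData

/-- The difference of the costs on the two sides of `ξ`, in terms of the primitive `A` of the density. -/
def costGap (α : ℝ) (A : ℝ → ℝ) (ξ : ℝ) : ℝ := 2 * ξ + α * (2 * A ξ - A 1 - A (-1))

/-- The turning point. -/
def turn (α : ℝ) (A : ℝ → ℝ) : ℝ :=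
  Classical.epsilon fun ξ => ξ ∈ Ioo (-1 : ℝ) 1 ∧ costGap α A ξ = 0

lemma turn_spec {α k : ℝ} {A : ℝ → ℝ} (hα : 0 ≤ α) (hA : Prim k A) :
    turn α A ∈ Ioo (-1 : ℝ) 1 ∧ costGap α A (turn α A) = 0 := by
  refine Classical.epsilon_spec (p := fun ξ => ξ ∈ Ioo (-1 : ℝ) 1 ∧ costGap α A ξ = 0) ?_
  have hc : ContinuousOn (costGap α A) (Icc (-1) 1) := by
    have := hA.continuous
    unfold costGap
    fun_prop
  have hm := mul_nonneg hα (sub_nonneg.2 (hA.mono (by norm_num : (-1 : ℝ) ≤ 1)))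
  have h0 : (0 : ℝ) ∈ Ioo (costGap α A (-1)) (costGap α A 1) := by
    constructor <;> simp only [costGap] <;> linarith
  obtain ⟨ξ, h1, h2⟩ := intermediate_value_Ioo (by norm_num) hc h0
  exact ⟨ξ, h1, h2⟩

lemma abs_turn_sub_le_costGap {α k : ℝ} {A : ℝ → ℝ} (hα : 0 ≤ α) (hA : Prim k A) (ξ : ℝ) :
    2 * |turn α A - ξ| ≤ |costGap α A ξ| := by
  have h1 := (turn_spec hα hA).2
  simp only [costGap] at h1 ⊢
  rcases le_total (turn α A) ξ with h | h
  · rw [abs_sub_comm, abs_of_nonneg (sub_nonneg.2 h)]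
    refine le_trans ?_ (le_abs_self _)
    linarith [mul_nonneg hα (sub_nonneg.2 (hA.mono h))]
  · rw [abs_of_nonneg (sub_nonneg.2 h)]
    refine le_trans ?_ (neg_le_abs _)
    linarith [mul_nonneg hα (sub_nonneg.2 (hA.mono h))]

lemma abs_turn_sub_le {α k e : ℝ} {A B : ℝ → ℝ} (hα : 0 ≤ α) (hA : Prim k A) (hB : Prim k B)
    (h : ∀ x, |A x - B x| ≤ e) : |turn α A - turn α B| ≤ 2 * α * e := by
  have h1 := abs_turn_sub_le_costGap hα hA (turn α B)
  have h2 := (turn_spec hα hB).2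
  have h3 : |costGap α A (turn α B)| ≤ α * (4 * e) := by
    have e1 : costGap α A (turn α B) = α * (2 * (A (turn α B) - B (turn α B)) - (A 1 - B 1)
        - (A (-1) - B (-1))) := by
      simp only [costGap] at h2 ⊢
      linarith
    rw [e1, abs_mul, abs_of_nonneg hα]
    refine mul_le_mul_of_nonneg_left ?_ hα
    have h4 := abs_le.1 (h (turn α B))
    have h5 := abs_le.1 (h 1)
    have h6 := abs_le.1 (h (-1))
    rw [abs_le]
    constructor <;> linarith
  linarith

/-- A run of the splitting scheme with time step `h` and interface positions `ξ`. -/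
structure Chain (R M : ℝ) (g : ℝ → ℝ) (h : ℝ) (u : ℕ → ℝ → ℝ) (ξ : ℕ → ℝ) : Prop where
  succ : ∀ n, u (n + 1) = step M g h (ξ n) (u n)
  prim : ∀ n, Prim R (u n)

lemma Chain.refl {R M h : ℝ} {g : ℝ → ℝ} {u : ℕ → ℝ → ℝ} {ξ : ℕ → ℝ} (hu : Chain R M g h u ξ) :
    Chain R M g h (fun n => refl (u n)) (fun n => -ξ n) :=
  ⟨fun n => by rw [hu.succ, step_refl], fun n => (hu.prim n).refl⟩

/-- `w` lies above a line of slope `p ∈ [0, R]` through `(x, w x)`, up to an error `ε|x' - x|`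
at distance `δ ε * τ`. -/
def SemiConv (R : ℝ) (δ : ℝ → ℝ) (τ : ℝ) (w : ℝ → ℝ) (x : ℝ) : Prop :=
  ∃ p ∈ Icc 0 R, ∀ ε > 0, ∀ x', |x' - x| ≤ δ ε * τ → w x + p * (x' - x) - ε * |x' - x| ≤ w x'

lemma SemiConv.abs_sub_le {R τ p r ε z y : ℝ} {δ w : ℝ → ℝ} (hw : SemiConv R δ τ w y)
    (hδ : ∀ ε > 0, 0 < δ ε) (hτ : 0 < τ) (hε : 0 < ε) (hd : HasDerivAt w p y)
    (hz : 0 < z) (hz' : z ≤ δ ε * τ) (h1 : |w (y + z) - w y - r * z| ≤ ε * z)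
    (h2 : |w (y - z) - w y + r * z| ≤ ε * z) : |p - r| ≤ 2 * ε := by
  obtain ⟨p', -, hp'⟩ := hw
  have hpp : p' = p := by
    refine eq_of_forall_dist_le fun e he => ?_
    have he2 : 0 < e / 2 := by linarith
    have hd' := (hasDerivAt_iff_isLittleO_nhds_zero.1 hd).def he2
    obtain ⟨r₀, hr₀, hb⟩ := Metric.eventually_nhds_iff.1 hd'
    have hpos := mul_pos (hδ _ he2) hτ
    obtain ⟨s, hs, hs'⟩ := exists_between (lt_min hr₀ hpos)
    have ha : |s| = s := abs_of_pos hs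
    have e1 := hb (y := s)
      (by rw [Real.dist_eq, sub_zero, ha]; exact hs'.trans_le (min_le_left _ _))
    have e2 := hb (y := -s)
      (by rw [Real.dist_eq, sub_zero, abs_neg, ha]; exact hs'.trans_le (min_le_left _ _))
    rw [Real.norm_eq_abs, Real.norm_eq_abs, ha, smul_eq_mul] at e1
    rw [Real.norm_eq_abs, Real.norm_eq_abs, abs_neg, ha, smul_eq_mul] at e2
    have hsl := hs'.le.trans (min_le_right _ _)
    have f1 := hp' _ he2 (y + s) (by simpa [ha] using hsl)
    have f2 := hp' _ he2 (y + -s) (by simpa [ha] using hsl)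
    simp only [add_sub_cancel_left, abs_neg, ha] at f1 f2
    rw [abs_le] at e1 e2
    rw [Real.dist_eq, abs_le]
    constructor <;> refine le_of_mul_le_mul_right ?_ hs <;> nlinarith
  subst hpp
  have ha : |z| = z := abs_of_pos hz
  have f1 := hp' ε hε (y + z) (by simpa [ha] using hz')
  have f2 := hp' ε hε (y - z) (by simpa [ha] using hz')
  simp only [add_sub_cancel_left, sub_sub_cancel_left, abs_neg, ha] at f1 f2
  rw [abs_le] at h1 h2 ⊢
  constructor <;> refine le_of_mul_le_mul_right ?_ hz <;> nlinarith

lemma SemiConv.mono {R τ τ' x : ℝ} {δ w : ℝ → ℝ} (hw : SemiConv R δ τ w x)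
    (hδ : ∀ ε > 0, 0 < δ ε) (h : τ' ≤ τ) : SemiConv R δ τ' w x := by
  obtain ⟨p, hp, H⟩ := hw
  exact ⟨p, hp, fun ε hε x' hx' =>
    H ε hε x' (hx'.trans (mul_le_mul_of_nonneg_left h (hδ ε hε).le))⟩

namespace LegendreData

variable {R M h ξb : ℝ} {f g P δ : ℝ → ℝ} {u : ℕ → ℝ → ℝ} {ξ : ℕ → ℝ}

lemma chain_abs_sub_le (H : LegendreData R M f g P δ) (hh : 0 ≤ h) (hu : Chain R M g h u ξ)
    (n m : ℕ) (x : ℝ) : |u (n + m) x - u n x| ≤ m * h * g 0 := by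
  induction m with
  | zero => simp
  | succ m ih =>
    have h1 := H.abs_step_sub_le hh (hu.prim (n + m)) (ξ (n + m)) x
    rw [← hu.succ] at h1
    rw [← add_assoc]
    push_cast
    calc |u (n + m + 1) x - u n x| ≤ |u (n + m + 1) x - u (n + m) x| + |u (n + m) x - u n x| :=
          abs_sub_le _ _ _
      _ ≤ _ := by linarith

lemma chain_tail (H : LegendreData R M f g P δ) (hh : 0 ≤ h) (hu : Chain R M g h u ξ) {b c : ℝ}
    (hξ : ∀ n, ξ n ≤ b) (hb : ∀ x, b ≤ x → u 0 x = c) (n : ℕ) :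
    ∀ x, b + n * h * M ≤ x → u n x = c := by
  induction n with
  | zero => simpa using hb
  | succ n ih =>
    intro x hx
    rw [hu.succ]
    have := mul_nonneg (mul_nonneg (Nat.cast_nonneg (α := ℝ) n) hh) H.M_pos.le
    refine H.step_tail hh (hu.prim n) (by linarith [hξ n]) ih ?_
    push_cast at hx
    linarith

lemma chain_lower (H : LegendreData R M f g P δ) (hh : 0 ≤ h) (hu : Chain R M g h u ξ)
    (n m : ℕ) (hξ : ∀ i, n ≤ i → i < n + m → ξ i ≤ ξb) {x q : ℝ} (hx : ξb ≤ x)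
    (hq : ξb ≤ x - m * h * q) : u n (x - m * h * q) - m * h * g q ≤ u (n + m) x := by
  induction m generalizing x with
  | zero => simp
  | succ m ih =>
    push_cast at hq ⊢
    have hx1 : ξb ≤ x - h * q := by
      rcases le_total q 0 with h0 | h0
      · linarith [mul_nonneg hh (neg_nonneg.2 h0)]
      · linarith [mul_nonneg (mul_nonneg (Nat.cast_nonneg (α := ℝ) m) hh) h0]
    have h1 := ih (fun i h1 h2 => hξ i h1 (by omega)) hx1 (by linarith)
    have h2 := H.le_rightOp (ξ := ξ (n + m)) hh (hu.prim (n + m)) x q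
    rw [← H.step_of_ge hh (hu.prim (n + m)) ((hξ (n + m) (by omega) (by omega)).trans hx),
      ← hu.succ] at h2
    rw [← add_assoc]
    have e : x - h * q - m * h * q = x - (m + 1) * h * q := by ring
    rw [e] at h1
    linarith

lemma chain_upper (H : LegendreData R M f g P δ) (hh : 0 < h) (hu : Chain R M g h u ξ)
    (n m : ℕ) (hξ : ∀ i, n ≤ i → i < n + m → ξ i ≤ ξb) {x : ℝ} (hx : ξb + m * h * M ≤ x) :
    ∃ q ∈ Icc (-M) M, u (n + m) x ≤ u n (x - m * h * q) - m * h * g q := by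
  induction m generalizing x with
  | zero => exact ⟨0, by constructor <;> linarith [H.M_pos], by simp⟩
  | succ m ih =>
    push_cast at hx
    have hmh := mul_nonneg (Nat.cast_nonneg (α := ℝ) m) hh.le
    have hmM := mul_nonneg hmh H.M_pos.le
    have hhM := mul_nonneg hh.le H.M_pos.le
    have hn := hξ (n + m) (by omega) (by omega)
    obtain ⟨q₁, hq₁, e⟩ := H.rightOp_attained (h := h) (hu.prim (n + m)) (ξ (n + m)) x
    have hq₁' := mul_le_mul_of_nonneg_left hq₁.2 hh.le
    rw [← H.step_of_ge hh.le (hu.prim (n + m)) (by linarith), ← hu.succ,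
      max_eq_left (by linarith)] at e
    obtain ⟨q₂, hq₂, e2⟩ := ih (fun i h1 h2 => hξ i h1 (by omega)) (x := x - h * q₁) (by linarith)
    have hp := H.g_perspective (s := m * h * q₂) (t := h * q₁) hmh hh
      (fun h0 => by rw [h0, zero_mul])
    have hs : (m : ℝ) * h * g (m * h * q₂ / (m * h)) = m * h * g q₂ := by
      rcases eq_or_ne ((m : ℝ) * h) 0 with h0 | h0
      · rw [h0, zero_mul, zero_mul]
      · rw [mul_div_cancel_left₀ _ h0]
    rw [hs, mul_div_cancel_left₀ _ hh.ne'] at hp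
    have hpos : 0 < (m : ℝ) * h + h := by linarith
    refine ⟨(m * h * q₂ + h * q₁) / (m * h + h), ⟨?_, ?_⟩, ?_⟩
    · rw [le_div_iff₀ hpos]
      nlinarith [mul_le_mul_of_nonneg_left hq₂.1 hmh, mul_le_mul_of_nonneg_left hq₁.1 hh.le]
    · rw [div_le_iff₀ hpos]
      nlinarith [mul_le_mul_of_nonneg_left hq₂.2 hmh, mul_le_mul_of_nonneg_left hq₁.2 hh.le]
    · have e3 : ((m + 1 : ℕ) : ℝ) * h = m * h + h := by push_cast; ring
      rw [e3, mul_div_cancel₀ _ hpos.ne', ← add_assoc]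
      have e4 : x - h * q₁ - m * h * q₂ = x - (m * h * q₂ + h * q₁) := by ring
      rw [e4] at e2
      linarith

lemma chain_consistent (H : LegendreData R M f g P δ) (hh : 0 < h) (hu : Chain R M g h u ξ)
    (n m : ℕ) (hξ : ∀ i, n ≤ i → i < n + m → ξ i ≤ ξb) {x r η : ℝ} (hr : r ∈ Icc 0 R)
    (hx : ξb + m * h * M ≤ x)
    (hη : ∀ q ∈ Icc (-M) M, |u n (x - m * h * q) - u n x + m * h * q * r| ≤ η) :
    |u (n + m) x - u n x + m * h * f r| ≤ η := by
  have hmh := mul_nonneg (Nat.cast_nonneg (α := ℝ) m) hh.le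
  have hmM := mul_nonneg hmh H.M_pos.le
  rw [abs_le]
  constructor
  · obtain ⟨q, hq, hd⟩ := H.exists_dual r hr
    have h1 := H.chain_lower hh.le hu n m hξ (x := x) (q := q) (by linarith)
      (by linarith [mul_le_mul_of_nonneg_left hq.2 hmh])
    have h2 := (abs_le.1 (hη q hq)).1
    have h3 := mul_le_mul_of_nonneg_left hd hmh
    linarith
  · obtain ⟨q, hq, h1⟩ := H.chain_upper hh hu n m hξ hx
    have h2 := (abs_le.1 (hη q hq)).2
    have h3 := mul_le_mul_of_nonneg_left (H.le_g q r hr) hmh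
    linarith

lemma chain_semiConv (H : LegendreData R M f g P δ) (hh : 0 < h) (hu : Chain R M g h u ξ)
    (n m : ℕ) (hm : 0 < m) (hξ : ∀ i, n ≤ i → i < n + m → ξ i ≤ ξb) {x : ℝ}
    (hx : ξb + m * h * (M + 1) ≤ x) : SemiConv R δ (m * h) (u (n + m)) x := by
  have hτ : 0 < (m : ℝ) * h := mul_pos (Nat.cast_pos.2 hm) hh
  set τ := (m : ℝ) * h with hτd
  have hτM := mul_pos hτ H.M_pos
  obtain ⟨q, hq, h1⟩ := H.chain_upper hh hu n m hξ (x := x) (by linarith)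
  rw [← hτd] at h1
  refine ⟨P q, H.P_mem q, fun ε hε x' hx' => ?_⟩
  have hx1 : |x' - x| ≤ τ := hx'.trans (by nlinarith [H.δ_le ε])
  have hq2 := mul_le_mul_of_nonneg_left hq.2 hτ.le
  have e : x' - τ * (q + (x' - x) / τ) = x - τ * q := by field_simp; ring
  have h2 := H.chain_lower hh.le hu n m hξ (x := x') (q := q + (x' - x) / τ)
    (by linarith [(abs_le.1 hx1).1]) (by rw [← hτd, e]; linarith)
  rw [← hτd, e] at h2
  have h3 := H.g_le_modulus (q := q) (q' := q + (x' - x) / τ) hε (by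
    rw [add_sub_cancel_left, abs_div, abs_of_pos hτ, div_le_iff₀ hτ]
    exact hx')
  rw [add_sub_cancel_left, abs_div, abs_of_pos hτ] at h3
  have h4 := mul_le_mul_of_nonneg_left h3 hτ.le
  have e2 : τ * (g q - P q * ((x' - x) / τ) + ε * (|x' - x| / τ)) =
      τ * g q - P q * (x' - x) + ε * |x' - x| := by field_simp
  linarith

end LegendreData

lemma abs_floor_mul_sub_le {h : ℝ} (hh : 0 < h) (t : ℝ) :
    |(⌊t / h⌋₊ : ℝ) * h - max t 0| ≤ h := by
  rcases le_total t 0 with ht | ht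
  · rw [Nat.floor_of_nonpos (div_nonpos_of_nonpos_of_nonneg ht hh.le), max_eq_right ht]
    simpa using hh.le
  · rw [max_eq_left ht]
    have h1 := Nat.floor_le (div_nonneg ht hh.le)
    have h2 := Nat.lt_floor_add_one (t / h)
    rw [le_div_iff₀ hh] at h1
    rw [div_lt_iff₀ hh] at h2
    rw [abs_le]
    constructor <;> linarith

lemma abs_floor_sub_floor_le {h : ℝ} (hh : 0 < h) (s t : ℝ) :
    h * |(⌊t / h⌋₊ : ℝ) - ⌊s / h⌋₊| ≤ |t - s| + 2 * h := by
  have h1 := abs_floor_mul_sub_le hh t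
  have h2 := abs_floor_mul_sub_le hh s
  have h3 : |max t 0 - max s 0| ≤ |t - s| := abs_max_sub_max_le_abs t s 0
  rw [← abs_of_pos hh, ← abs_mul, abs_of_pos hh]
  rw [abs_le] at h1 h2 h3 ⊢
  constructor <;> linarith

/-- A sequence of runs of the scheme, with vanishing time steps, that converges to `(w, ζ)`. -/
structure Approx (R M L : ℝ) (g : ℝ → ℝ) (h : ℕ → ℝ) (u : ℕ → ℕ → ℝ → ℝ) (ξ : ℕ → ℕ → ℝ)
    (w : ℝ → ℝ → ℝ) (ζ : ℝ → ℝ) : Prop where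
  h_pos : ∀ j, 0 < h j
  h_lim : Tendsto h atTop (𝓝 0)
  chain : ∀ j, Chain R M g (h j) (u j) (ξ j)
  initial : ∀ j, u j 0 = w 0
  L_nonneg : 0 ≤ L
  xi_lip : ∀ j n m, |ξ j n - ξ j m| ≤ L * (h j * |(n : ℝ) - m|)
  lip : ∀ j n m x, |u j n x - u j m x| ≤ L * (h j * |(n : ℝ) - m|)
  lim : ∀ t x, Tendsto (fun j => u j ⌊t / h j⌋₊ x) atTop (𝓝 (w t x))
  xi_lim : ∀ t, Tendsto (fun j => ξ j ⌊t / h j⌋₊) atTop (𝓝 (ζ t))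

/-- The splitting scheme with the interface placed at the turning point. -/
def scheme (M : ℝ) (g : ℝ → ℝ) (α h : ℝ) (u₀ : ℝ → ℝ) : ℕ → ℝ → ℝ
  | 0 => u₀
  | n + 1 => step M g h (turn α (scheme M g α h u₀ n)) (scheme M g α h u₀ n)

namespace LegendreData

variable {R M : ℝ} {f g P δ : ℝ → ℝ}

lemma chain_lip (H : LegendreData R M f g P δ) {h : ℝ} {u : ℕ → ℝ → ℝ} {ξ : ℕ → ℝ} (hh : 0 ≤ h)
    (hu : Chain R M g h u ξ) (n m : ℕ) (x : ℝ) :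
    |u n x - u m x| ≤ g 0 * (h * |(n : ℝ) - m|) := by
  wlog hnm : m ≤ n generalizing n m
  · rw [abs_sub_comm, abs_sub_comm (n : ℝ)]
    exact this m n (le_of_not_ge hnm)
  obtain ⟨i, rfl⟩ := Nat.exists_eq_add_of_le hnm
  have := H.chain_abs_sub_le hh hu m i x
  push_cast
  rw [add_sub_cancel_left, Nat.abs_cast]
  linarith

lemma scheme_chain (H : LegendreData R M f g P δ) (α : ℝ) {h : ℝ} {u₀ : ℝ → ℝ} (hh : 0 < h)
    (hu₀ : Prim R u₀) :
    Chain R M g h (scheme M g α h u₀) (fun n => turn α (scheme M g α h u₀ n)) := by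
  refine ⟨fun n => rfl, fun n => ?_⟩
  induction n with
  | zero => exact hu₀
  | succ n ih => exact H.step_prim hh H.R_pos.le le_rfl ih _

lemma exists_approx (H : LegendreData R M f g P δ) {α : ℝ} (hα : 0 ≤ α) {u₀ : ℝ → ℝ}
    (hu₀ : Prim R u₀) : ∃ L h u ξ w, w 0 = u₀ ∧ (∀ j n, ξ j n = turn α (u j n)) ∧
      Approx R M L g h u ξ w fun t => turn α (w t) := by
  set η : ℕ → ℝ := fun j => 1 / ((j : ℝ) + 1) with hη
  have hηpos : ∀ j, 0 < η j := fun j => Nat.one_div_pos_of_nat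
  have hηlim : Tendsto η atTop (𝓝 0) := tendsto_one_div_add_atTop_nhds_zero_nat
  set W : ℕ → ℕ → ℝ → ℝ := fun j => scheme M g α (η j) u₀ with hW
  have hch : ∀ j, Chain R M g (η j) (W j) (fun n => turn α (W j n)) :=
    fun j => H.scheme_chain α (hηpos j) hu₀
  have hg0 := H.g_nonneg 0
  have hlip := fun j => H.chain_lip (hηpos j).le (hch j)
  have htime : ∀ j s t x, |W j ⌊t / η j⌋₊ x - W j ⌊s / η j⌋₊ x| ≤ g 0 * (|t - s| + 2 * η j) :=
    fun j s t x => (hlip j _ _ x).trans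
      (mul_le_mul_of_nonneg_left (abs_floor_sub_floor_le (hηpos j) s t) hg0)
  have hspace : ∀ j n x y, |W j n x - W j n y| ≤ R * |x - y| :=
    fun j n x y => ((hch j).prim n).abs_sub_le x y
  obtain ⟨a, -, φ, hφ, ha⟩ := (isCompact_univ_pi fun z : ℚ × ℚ =>
      isCompact_Icc (a := u₀ z.2 - g 0 * (|(z.1 : ℝ)| + 2)) (b := u₀ z.2 + g 0 * (|(z.1 : ℝ)| + 2))
    ).tendsto_subseq (x := fun j z => W j ⌊(z.1 : ℝ) / η j⌋₊ z.2) (by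
      intro j z _
      have h1 := htime j 0 z.1 z.2
      have h2 : η j ≤ 1 := by
        simp only [hη]
        rw [div_le_one (by positivity)]
        linarith [Nat.cast_nonneg (α := ℝ) j]
      simp only [zero_div, Nat.floor_zero, sub_zero] at h1
      have h3 := mul_le_mul_of_nonneg_left h2 hg0
      have h4 : W j 0 = u₀ := rfl
      rw [h4, abs_le] at h1
      constructor <;> linarith)
  have hφlim := hηlim.comp hφ.tendsto_atTop
  have key : ∀ t x, ∃ l, Tendsto (fun j => W (φ j) ⌊t / η (φ j)⌋₊ x) atTop (𝓝 l) := by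
    intro t x
    refine cauchySeq_tendsto_of_complete (Metric.cauchySeq_iff.2 fun ε hε => ?_)
    obtain ⟨κ, hκ, hκ'⟩ : ∃ κ > 0, g 0 * (3 * κ) + R * κ < ε / 3 := by
      refine ⟨ε / 3 / (g 0 * 3 + R + 1), by have := H.R_pos; positivity, ?_⟩
      have hpos : 0 < g 0 * 3 + R + 1 := by linarith [H.R_pos]
      have : g 0 * (3 * (ε / 3 / (g 0 * 3 + R + 1))) + R * (ε / 3 / (g 0 * 3 + R + 1)) =
        ε / 3 - ε / 3 / (g 0 * 3 + R + 1) := by field_simp; ring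
      rw [this]
      have : 0 < ε / 3 / (g 0 * 3 + R + 1) := by positivity
      linarith
    obtain ⟨t', ht1, ht2⟩ := exists_rat_btwn (show t < t + κ by linarith)
    obtain ⟨x', hx1, hx2⟩ := exists_rat_btwn (show x < x + κ by linarith)
    have hc := (tendsto_pi_nhds.1 ha (t', x')).cauchySeq
    obtain ⟨N, hN⟩ := Metric.cauchySeq_iff.1 hc (ε / 3) (by linarith)
    obtain ⟨N', hN'⟩ := eventually_atTop.1 (hφlim.eventually (gt_mem_nhds hκ))
    have hclose : ∀ j ≥ N',
        |W (φ j) ⌊t / η (φ j)⌋₊ x - W (φ j) ⌊(t' : ℝ) / η (φ j)⌋₊ x'| < ε / 3 := by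
      intro j hj
      have h1 := htime (φ j) t' t x
      have h2 := hspace (φ j) ⌊(t' : ℝ) / η (φ j)⌋₊ x x'
      have h3 : η (φ j) < κ := hN' j hj
      have h4 : |t - t'| ≤ κ := by rw [abs_le]; constructor <;> linarith
      have h5 : |x - x'| ≤ κ := by rw [abs_le]; constructor <;> linarith
      have h6 := mul_le_mul_of_nonneg_left h5 H.R_pos.le
      have h7 : g 0 * (|t - t'| + 2 * η (φ j)) ≤ g 0 * (3 * κ) :=
        mul_le_mul_of_nonneg_left (by linarith) hg0
      exact lt_of_le_of_lt (abs_sub_le _ (W (φ j) ⌊(t' : ℝ) / η (φ j)⌋₊ x) _) (by linarith)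
    refine ⟨max N N', fun m hm n hn => ?_⟩
    have h1 := hclose m ((le_max_right _ _).trans hm)
    have h2 := hclose n ((le_max_right _ _).trans hn)
    have h3 := hN m ((le_max_left _ _).trans hm) n ((le_max_left _ _).trans hn)
    simp only [Function.comp, Real.dist_eq] at h3 ⊢
    rw [abs_lt] at h1 h2 h3 ⊢
    constructor <;> linarith
  choose w hw using key
  have hw0 : w 0 = u₀ := by
    ext x
    refine tendsto_nhds_unique (hw 0 x) ?_
    simp only [zero_div, Nat.floor_zero]
    exact tendsto_const_nhds
  have hwp : ∀ t, Prim R (w t) := fun t =>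
    ⟨fun x y hxy => le_of_tendsto_of_tendsto' (hw t x) (hw t y)
      fun j => ((hch (φ j)).prim _).mono hxy,
    fun x y hxy => le_of_tendsto' ((hw t y).sub (hw t x))
      fun j => ((hch (φ j)).prim _).sub_le x y hxy⟩
  refine ⟨max (g 0) (2 * α * g 0), fun j => η (φ j), fun j => W (φ j),
    fun j n => turn α (W (φ j) n), w, hw0, fun _ _ => rfl,
    ⟨fun j => hηpos _, hφlim, fun j => hch _, fun j => ?_, le_max_of_le_left hg0,
      fun j n m => ?_, fun j n m x => ?_, hw, fun t => ?_⟩⟩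
  · rw [hw0]
    rfl
  · refine (abs_turn_sub_le hα ((hch (φ j)).prim n) ((hch (φ j)).prim m)
      (hlip (φ j) n m)).trans ?_
    rw [← mul_assoc]
    exact mul_le_mul_of_nonneg_right (le_max_right _ _)
      (mul_nonneg (hηpos _).le (abs_nonneg _))
  · exact (hlip (φ j) n m x).trans (mul_le_mul_of_nonneg_right (le_max_left _ _)
      (mul_nonneg (hηpos _).le (abs_nonneg _)))
  · have h1 : Tendsto (fun j => |costGap α (W (φ j) ⌊t / η (φ j)⌋₊) (turn α (w t))|) atTop
        (𝓝 |costGap α (w t) (turn α (w t))|) := by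
      simp only [costGap]
      exact (((((hw t _).const_mul 2).sub (hw t 1)).sub (hw t (-1))).const_mul α
        |>.const_add _).abs
    rw [(turn_spec hα (hwp t)).2, abs_zero] at h1
    rw [tendsto_iff_dist_tendsto_zero]
    refine squeeze_zero (fun _ => dist_nonneg) (fun j => ?_) h1
    have h2 := abs_turn_sub_le_costGap hα ((hch (φ j)).prim ⌊t / η (φ j)⌋₊) (turn α (w t))
    rw [Real.dist_eq]
    linarith [abs_nonneg (turn α (W (φ j) ⌊t / η (φ j)⌋₊) - turn α (w t))]

end LegendreData

namespace Approx

variable {R M L : ℝ} {g : ℝ → ℝ} {h : ℕ → ℝ} {u : ℕ → ℕ → ℝ → ℝ} {ξ : ℕ → ℕ → ℝ}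
  {w : ℝ → ℝ → ℝ} {ζ : ℝ → ℝ}

lemma refl (K : Approx R M L g h u ξ w ζ) :
    Approx R M L g h (fun j n => Hughes.refl (u j n)) (fun j n => -ξ j n)
      (fun t => Hughes.refl (w t)) (fun t => -ζ t) where
  h_pos := K.h_pos
  h_lim := K.h_lim
  chain j := (K.chain j).refl
  initial j := by rw [K.initial j]
  L_nonneg := K.L_nonneg
  xi_lip j n m := by
    have := K.xi_lip j n m
    rwa [← abs_neg, neg_sub, ← neg_sub_neg] at this
  lip j n m x := by
    have := K.lip j n m (-x)
    rwa [← abs_neg, neg_sub, ← neg_sub_neg] at this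
  lim t x := (K.lim t (-x)).neg
  xi_lim t := (K.xi_lim t).neg

lemma prim (K : Approx R M L g h u ξ w ζ) (t : ℝ) : Prim R (w t) :=
  ⟨fun x y hxy => le_of_tendsto_of_tendsto' (K.lim t x) (K.lim t y)
      fun j => ((K.chain j).prim _).mono hxy,
    fun x y hxy => le_of_tendsto' ((K.lim t y).sub (K.lim t x))
      fun j => ((K.chain j).prim _).sub_le x y hxy⟩

lemma interp_sub_le (K : Approx R M L g h u ξ w ζ) (j : ℕ) (s t x : ℝ) :
    |u j ⌊t / h j⌋₊ x - u j ⌊s / h j⌋₊ x| ≤ L * (|t - s| + 2 * h j) :=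
  (K.lip j _ _ x).trans
    (mul_le_mul_of_nonneg_left (abs_floor_sub_floor_le (K.h_pos j) s t) K.L_nonneg)

lemma abs_sub_le (K : Approx R M L g h u ξ w ζ) (s t x : ℝ) :
    |w t x - w s x| ≤ L * |t - s| := by
  have h1 : Tendsto (fun j => L * (|t - s| + 2 * h j)) atTop (𝓝 (L * (|t - s| + 2 * 0))) :=
    ((K.h_lim.const_mul 2).const_add _).const_mul L
  rw [mul_zero, add_zero] at h1
  exact le_of_tendsto_of_tendsto' ((K.lim t x).sub (K.lim s x)).abs h1
    fun j => K.interp_sub_le j s t x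

lemma xi_abs_sub_le (K : Approx R M L g h u ξ w ζ) (s t : ℝ) : |ζ t - ζ s| ≤ L * |t - s| := by
  have h1 : Tendsto (fun j => L * (|t - s| + 2 * h j)) atTop (𝓝 (L * (|t - s| + 2 * 0))) :=
    ((K.h_lim.const_mul 2).const_add _).const_mul L
  rw [mul_zero, add_zero] at h1
  exact le_of_tendsto_of_tendsto' ((K.xi_lim t).sub (K.xi_lim s)).abs h1
    fun j => (K.xi_lip j _ _).trans
      (mul_le_mul_of_nonneg_left (abs_floor_sub_floor_le (K.h_pos j) s t) K.L_nonneg)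

lemma continuous (K : Approx R M L g h u ξ w ζ) : Continuous (Function.uncurry w) := by
  rw [continuous_iff_continuousAt]
  rintro ⟨t, x⟩
  rw [ContinuousAt, tendsto_iff_dist_tendsto_zero]
  have h1 : Tendsto (fun z : ℝ × ℝ => L * |z.1 - t| + R * |z.2 - x|) (𝓝 (t, x))
      (𝓝 (L * |t - t| + R * |x - x|)) := Continuous.tendsto (by fun_prop) (t, x)
  simp only [sub_self, abs_zero, mul_zero, add_zero] at h1
  refine squeeze_zero (fun _ => dist_nonneg) (fun z => ?_) h1
  rw [Real.dist_eq]
  refine (_root_.abs_sub_le _ (w t z.2) _).trans (add_le_add ?_ ?_)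
  · exact K.abs_sub_le t z.1 z.2
  · exact (K.prim t).abs_sub_le z.2 x

end Approx

lemma SemiConv.of_tendsto {R τ x : ℝ} {δ w : ℝ → ℝ} {W : ℕ → ℝ → ℝ}
    (hW : ∀ x, Tendsto (fun j => W j x) atTop (𝓝 (w x)))
    (h : ∀ᶠ j in atTop, SemiConv R δ τ (W j) x) : SemiConv R δ τ w x := by
  obtain ⟨N, hN⟩ := eventually_atTop.1 h
  choose p hp hp' using fun j => hN (j + N) (by omega)
  obtain ⟨a, ha, φ, hφ, hlim⟩ := isCompact_Icc.tendsto_subseq hp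
  have hψ : Tendsto (fun j => φ j + N) atTop atTop :=
    tendsto_atTop_mono (fun j => Nat.le_add_right _ _) hφ.tendsto_atTop
  refine ⟨a, ha, fun ε hε x' hx' => le_of_tendsto_of_tendsto'
    ((((hW x).comp hψ).add (hlim.mul_const (x' - x))).sub_const _) ((hW x').comp hψ) fun j => ?_⟩
  exact hp' (φ j) ε hε x' hx'

lemma hasDerivAt_refl {A : ℝ → ℝ} {p x : ℝ} (h : HasDerivAt A p x) :
    HasDerivAt (refl A) p (-x) := by
  have h1 : HasDerivAt A p (-(-x)) := by rwa [neg_neg]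
  have h2 := (h1.comp (-x) (hasDerivAt_neg (-x))).neg
  rw [mul_neg_one, neg_neg] at h2
  exact h2

/-- Uniform semiconvexity turns pointwise convergence into convergence of derivatives. -/
lemma SemiConv.eventually_abs_deriv_sub_le {ι : Type*} {l : Filter ι} {R σ η₀ x r ε : ℝ}
    {δ w : ℝ → ℝ} {W : ι → ℝ → ℝ} (hR : 0 ≤ R) (hδ : ∀ ε > 0, 0 < δ ε) (hσ : 0 < σ) (hη₀ : 0 < η₀)
    (hW : ∀ x, Tendsto (fun j => W j x) l (𝓝 (w x))) (hP : ∀ j, Prim R (W j))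
    (h : ∀ᶠ j in l, ∀ y, |y - x| ≤ η₀ → SemiConv R δ σ (W j) y) (hd : HasDerivAt w r x)
    (hε : 0 < ε) :
    ∃ η > 0, ∀ᶠ j in l, ∀ y, |y - x| ≤ η → ∀ p, HasDerivAt (W j) p y → |p - r| ≤ ε := by
  set e := ε / 2 with he_def
  have he : 0 < e := by positivity
  have he4 : 0 < e / 4 := by positivity
  obtain ⟨r₀, hr₀, hb⟩ := Metric.eventually_nhds_iff.1
    ((hasDerivAt_iff_isLittleO_nhds_zero.1 hd).def he4)
  obtain ⟨z, hz, hz'⟩ := exists_between (lt_min hr₀ (mul_pos (hδ e he) hσ))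
  have ha : |z| = z := abs_of_pos hz
  have e1 := hb (y := z) (by rw [Real.dist_eq, sub_zero, ha]; exact hz'.trans_le (min_le_left _ _))
  have e2 := hb (y := -z)
    (by rw [Real.dist_eq, sub_zero, abs_neg, ha]; exact hz'.trans_le (min_le_left _ _))
  rw [Real.norm_eq_abs, Real.norm_eq_abs, ha, smul_eq_mul] at e1
  rw [Real.norm_eq_abs, Real.norm_eq_abs, abs_neg, ha, smul_eq_mul] at e2
  have hez : 0 < e / 8 * z := by positivity
  have hη : 0 < e * z / (4 * R + 1) := by positivity
  have hRη : 2 * (R * (e * z / (4 * R + 1))) ≤ e / 2 * z := by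
    rw [mul_div_assoc', mul_div_assoc', div_le_iff₀ (by positivity)]
    nlinarith [mul_pos he hz]
  refine ⟨min η₀ (e * z / (4 * R + 1)), lt_min hη₀ hη, ?_⟩
  filter_upwards [h, (hW x).eventually (Metric.closedBall_mem_nhds _ hez),
    (hW (x + z)).eventually (Metric.closedBall_mem_nhds _ hez),
    (hW (x + -z)).eventually (Metric.closedBall_mem_nhds _ hez)] with j hj h0 h1 h2 y hy p hp
  simp only [Real.dist_eq] at h0 h1 h2
  have hyR := mul_le_mul_of_nonneg_left (hy.trans (min_le_right _ _)) hR
  have f0 := (hP j).abs_sub_le y x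
  have f1 := (hP j).abs_sub_le (y + z) (x + z)
  have f2 := (hP j).abs_sub_le (y - z) (x + -z)
  rw [add_sub_add_right_eq_sub] at f1
  rw [show y - z - (x + -z) = y - x by ring] at f2
  have key := (hj y (hy.trans (min_le_left _ _))).abs_sub_le hδ hσ he hp (r := r) hz
    (hz'.le.trans (min_le_right _ _)) (by rw [abs_le] at *; constructor <;> linarith)
    (by rw [abs_le] at *; constructor <;> linarith)
  linarith

namespace Approx

variable {R M L : ℝ} {f g P δ : ℝ → ℝ} {h : ℕ → ℝ} {u : ℕ → ℕ → ℝ → ℝ} {ξ : ℕ → ℕ → ℝ}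
  {w : ℝ → ℝ → ℝ} {ζ : ℝ → ℝ}

lemma semiConv_window (K : Approx R M L g h u ξ w ζ) (H : LegendreData R M f g P δ) {t x : ℝ}
    (ht : 0 < t) (hx : ζ t < x) :
    ∃ κ > 0, ∀ᶠ j in atTop, ∀ s, |s - t| ≤ κ → ∀ y, |y - x| ≤ κ →
      SemiConv R δ (κ / 2) (u j ⌊s / h j⌋₊) y := by
  have hL := K.L_nonneg
  have hM := H.M_pos
  have hpos : 0 < 3 * L + M + 3 := by positivity
  set κ := min (t / 2) ((x - ζ t) / (3 * L + M + 3)) with hκ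
  have hκpos : 0 < κ := lt_min (by linarith) (div_pos (by linarith) hpos)
  have hκt : κ ≤ t / 2 := min_le_left _ _
  have hκx : κ * (3 * L + M + 3) ≤ x - ζ t := by
    rw [← le_div_iff₀ hpos]
    exact min_le_right _ _
  refine ⟨κ, hκpos, ?_⟩
  filter_upwards [K.h_lim.eventually (gt_mem_nhds (show 0 < κ / 2 by linarith)),
    (K.xi_lim t).eventually (gt_mem_nhds (show ζ t < ζ t + κ by linarith))] with j hj hξj s hs y hy
  have hh := K.h_pos j
  have hs0 : κ ≤ s := by linarith [(abs_le.1 hs).1]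
  have hmN : ⌊κ / h j⌋₊ ≤ ⌊s / h j⌋₊ := Nat.floor_mono (div_le_div_of_nonneg_right hs0 hh.le)
  obtain ⟨n, hn⟩ := Nat.exists_eq_add_of_le' hmN
  have hm1 : (⌊κ / h j⌋₊ : ℝ) * h j ≤ κ := by
    have := Nat.floor_le (div_nonneg hκpos.le hh.le)
    rwa [le_div_iff₀ hh] at this
  have hm2 : κ / 2 ≤ (⌊κ / h j⌋₊ : ℝ) * h j := by
    have := abs_floor_mul_sub_le hh κ
    rw [max_eq_left hκpos.le] at this
    linarith [(abs_le.1 this).1]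
  have hm0 : 0 < ⌊κ / h j⌋₊ := by
    rcases Nat.eq_zero_or_pos ⌊κ / h j⌋₊ with h0 | h0
    · rw [h0, Nat.cast_zero, zero_mul] at hm2
      linarith
    · exact h0
  rw [hn]
  refine (H.chain_semiConv hh (K.chain j) n _ hm0 (ξb := ζ t + κ + L * (3 * κ))
    (fun i hi1 hi2 => ?_) ?_).mono H.δ_pos hm2
  · have h1 := (abs_le.1 (K.xi_lip j i ⌊t / h j⌋₊)).2
    have h2 : h j * |(i : ℝ) - ⌊t / h j⌋₊| ≤ 3 * κ := by
      have h3 := abs_floor_sub_floor_le hh t s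
      rw [← abs_of_pos hh, ← abs_mul, abs_of_pos hh, abs_le] at h3 ⊢
      have h4 : (i : ℝ) ≤ ⌊s / h j⌋₊ := by exact_mod_cast (by omega : i ≤ ⌊s / h j⌋₊)
      have h5 : (⌊s / h j⌋₊ : ℝ) ≤ i + ⌊κ / h j⌋₊ := by
        exact_mod_cast (by omega : ⌊s / h j⌋₊ ≤ i + ⌊κ / h j⌋₊)
      have h6 := mul_le_mul_of_nonneg_left h4 hh.le
      have h7 := mul_le_mul_of_nonneg_left h5 hh.le
      constructor <;> linarith
    linarith [mul_le_mul_of_nonneg_left h2 hL]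
  · have h1 := mul_le_mul_of_nonneg_right hm1 (show 0 ≤ M + 1 by linarith)
    linarith [(abs_le.1 hy).1]

lemma eventually_abs_deriv_sub_le (K : Approx R M L g h u ξ w ζ) (H : LegendreData R M f g P δ)
    {t x r ε : ℝ} (ht : 0 < t) (hx : x ≠ ζ t) (hd : HasDerivAt (w t) r x) (hε : 0 < ε) :
    ∃ η > 0, ∀ᶠ j in atTop, ∀ y, |y - x| ≤ η → ∀ p,
      HasDerivAt (u j ⌊t / h j⌋₊) p y → |p - r| ≤ ε := by
  have key : ∀ {u : ℕ → ℕ → ℝ → ℝ} {ξ : ℕ → ℕ → ℝ} {w : ℝ → ℝ → ℝ} {ζ : ℝ → ℝ} {x : ℝ},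
      Approx R M L g h u ξ w ζ → ζ t < x → HasDerivAt (w t) r x →
      ∃ η > 0, ∀ᶠ j in atTop, ∀ y, |y - x| ≤ η → ∀ p,
        HasDerivAt (u j ⌊t / h j⌋₊) p y → |p - r| ≤ ε := by
    intro u ξ w ζ x K hx hd
    obtain ⟨κ, hκ, hK⟩ := K.semiConv_window H ht hx
    refine SemiConv.eventually_abs_deriv_sub_le H.R_pos.le H.δ_pos (half_pos hκ) hκ (K.lim t)
      (fun j => (K.chain j).prim _) ?_ hd hε
    filter_upwards [hK] with j hj y hy using hj t (by simpa using hκ.le) y hy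
  rcases lt_or_gt_of_ne hx with hx | hx
  · obtain ⟨η, hη, hK⟩ := key K.refl (neg_lt_neg hx) (hasDerivAt_refl hd)
    refine ⟨η, hη, ?_⟩
    filter_upwards [hK] with j hj y hy p hp
    exact hj (-y) (by rwa [neg_sub_neg, abs_sub_comm]) p (hasDerivAt_refl hp)
  · exact key K hx hd

lemma abs_deriv_sub_le_of_pos (K : Approx R M L g h u ξ w ζ) (H : LegendreData R M f g P δ)
    {t x r ε : ℝ} (ht : 0 < t) (hx : x ≠ ζ t) (hd : HasDerivAt (w t) r x) (hε : 0 < ε) :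
    ∀ᶠ s in 𝓝 t, ∀ p, HasDerivAt (w s) p x → |p - r| ≤ ε := by
  have key : ∀ {u : ℕ → ℕ → ℝ → ℝ} {ξ : ℕ → ℕ → ℝ} {w : ℝ → ℝ → ℝ} {ζ : ℝ → ℝ} {x : ℝ},
      Approx R M L g h u ξ w ζ → ζ t < x → HasDerivAt (w t) r x →
      ∀ᶠ s in 𝓝 t, ∀ p, HasDerivAt (w s) p x → |p - r| ≤ ε := by
    intro u ξ w ζ x K hx hd
    obtain ⟨κ, hκ, hK⟩ := K.semiConv_window H ht hx
    have h1 : ∀ᶠ s in 𝓝 t, ∀ y, |y - x| ≤ κ → SemiConv R δ (κ / 2) (w s) y := by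
      filter_upwards [Metric.closedBall_mem_nhds t hκ] with s hs y hy
      refine SemiConv.of_tendsto (K.lim s) ?_
      filter_upwards [hK] with j hj using hj s (by simpa [Real.dist_eq] using hs) y hy
    have h2 : ∀ x, Tendsto (fun s => w s x) (𝓝 t) (𝓝 (w t x)) := fun x =>
      (K.continuous.comp (by fun_prop : Continuous fun s : ℝ => (s, x))).tendsto t
    obtain ⟨η, hη, h3⟩ := SemiConv.eventually_abs_deriv_sub_le H.R_pos.le H.δ_pos (half_pos hκ) hκ
      h2 K.prim h1 hd hε
    filter_upwards [h3] with s hs using hs x (by simpa using hη.le)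
  rcases lt_or_gt_of_ne hx with hx | hx
  · filter_upwards [key K.refl (neg_lt_neg hx) (hasDerivAt_refl hd)] with s hs p hp
    exact hs p (hasDerivAt_refl hp)
  · exact key K hx hd

lemma abs_deriv_sub_le_of_zero (K : Approx R M L g h u ξ w ζ) (H : LegendreData R M f g P δ)
    {x r ε : ℝ} (hx : x ≠ ζ 0) (hd : HasDerivAt (w 0) r x) (hr : r ∈ Icc 0 R) (hε : 0 < ε) :
    ∀ᶠ s in 𝓝[>] (0 : ℝ), ∀ p, HasDerivAt (w s) p x → |p - r| ≤ ε := by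
  have key : ∀ {u : ℕ → ℕ → ℝ → ℝ} {ξ : ℕ → ℕ → ℝ} {w : ℝ → ℝ → ℝ} {ζ : ℝ → ℝ} {x : ℝ},
      Approx R M L g h u ξ w ζ → ζ 0 < x → HasDerivAt (w 0) r x →
      ∀ᶠ s in 𝓝[>] (0 : ℝ), ∀ p, HasDerivAt (w s) p x → |p - r| ≤ ε := by
    intro u ξ w ζ x K hx hd
    have hL := K.L_nonneg
    have hM := H.M_pos
    set e := ε / 2 with he_def
    have he : 0 < e := by positivity
    have hδe := H.δ_pos e he
    have hδ1 := H.δ_le e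
    set e₂ := e * δ e / (4 * (M + 2) + 2) with he₂_def
    have he₂ : 0 < e₂ := by positivity
    have he₂' : e₂ * (4 * (M + 2) + 2) = e * δ e := by
      rw [he₂_def]; field_simp
    obtain ⟨r₀, hr₀, hb⟩ := Metric.eventually_nhds_iff.1
      ((hasDerivAt_iff_isLittleO_nhds_zero.1 hd).def he₂)
    have hlin : ∀ y, |y| < r₀ → |w 0 (x + y) - w 0 x - r * y| ≤ e₂ * |y| := by
      intro y hy
      have := hb (y := y) (by rwa [Real.dist_eq, sub_zero])
      rwa [Real.norm_eq_abs, Real.norm_eq_abs, smul_eq_mul, mul_comm y] at this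
    have hpos : 0 < L + M + 3 := by positivity
    have hs₀ : 0 < min (r₀ / (M + 2)) ((x - ζ 0) / (L + M + 3)) :=
      lt_min (by positivity) (div_pos (by linarith) hpos)
    filter_upwards [Ioo_mem_nhdsGT hs₀] with s hs p hp
    have hs0 := hs.1
    have hs1 : s * (M + 2) < r₀ := by
      rw [← lt_div_iff₀ (by linarith)]
      exact hs.2.trans_le (min_le_left _ _)
    have hs2 : s * (L + M + 3) < x - ζ 0 := by
      rw [← lt_div_iff₀ hpos]
      exact hs.2.trans_le (min_le_right _ _)
    have hτlim : Tendsto (fun j => (⌊s / h j⌋₊ : ℝ) * h j) atTop (𝓝 s) := by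
      rw [tendsto_iff_dist_tendsto_zero]
      refine squeeze_zero (fun _ => dist_nonneg) (fun j => ?_) K.h_lim
      have := abs_floor_mul_sub_le (K.h_pos j) s
      rwa [max_eq_left hs0.le] at this
    have hτle : ∀ j, (⌊s / h j⌋₊ : ℝ) * h j ≤ s := fun j => by
      have := Nat.floor_le (div_nonneg hs0.le (K.h_pos j).le)
      rwa [le_div_iff₀ (K.h_pos j)] at this
    have hξ : ∀ᶠ j in atTop, ∀ i, 0 ≤ i → i < 0 + ⌊s / h j⌋₊ → ξ j i ≤ ζ 0 + s + L * s := by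
      have hξ0 := K.xi_lim 0
      simp only [zero_div, Nat.floor_zero] at hξ0
      filter_upwards [hξ0.eventually (gt_mem_nhds (show ζ 0 < ζ 0 + s by linarith))]
        with j hj i _ hi
      have h1 := (abs_le.1 (K.xi_lip j i 0)).2
      rw [Nat.cast_zero, sub_zero, Nat.abs_cast] at h1
      have h2 : (i : ℝ) ≤ ⌊s / h j⌋₊ := by exact_mod_cast (by omega : i ≤ ⌊s / h j⌋₊)
      have h3 := mul_le_mul_of_nonneg_left h2 (K.h_pos j).le
      have h4 : h j * i ≤ s := by linarith [hτle j]
      linarith [mul_le_mul_of_nonneg_left h4 hL]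
    have hsc : SemiConv R δ (s / 2) (w s) x := by
      refine SemiConv.of_tendsto (K.lim s) ?_
      filter_upwards [hξ, hτlim.eventually (lt_mem_nhds (half_lt_self hs0))] with j hj hτ
      have hm0 : 0 < ⌊s / h j⌋₊ := by
        rcases Nat.eq_zero_or_pos ⌊s / h j⌋₊ with h0 | h0
        · rw [h0, Nat.cast_zero, zero_mul] at hτ
          linarith
        · exact h0
      have := (H.chain_semiConv (K.h_pos j) (K.chain j) 0 _ hm0 hj (x := x) (by
        have := mul_le_mul_of_nonneg_right (hτle j) (show 0 ≤ M + 1 by linarith)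
        linarith)).mono H.δ_pos hτ.le
      rwa [zero_add] at this
    have hcons : ∀ x', |x' - x| ≤ s → |w s x' - w 0 x' + s * f r| ≤ e₂ * (M + 2) * s := by
      intro x' hx'
      have h1 : Tendsto (fun j => |u j ⌊s / h j⌋₊ x' - w 0 x' + ⌊s / h j⌋₊ * h j * f r|) atTop
          (𝓝 |w s x' - w 0 x' + s * f r|) :=
        (((K.lim s x').sub_const _).add (hτlim.mul_const _)).abs
      refine le_of_tendsto h1 ?_
      filter_upwards [hξ] with j hj
      have h2 := H.chain_consistent (K.h_pos j) (K.chain j) 0 ⌊s / h j⌋₊ hj (x := x')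
        (η := e₂ * (M + 2) * s) hr (by
          have := mul_le_mul_of_nonneg_right (hτle j) hM.le
          linarith [(abs_le.1 hx').1]) (fun q hq => ?_)
      · rwa [zero_add, K.initial j] at h2
      · rw [K.initial j]
        set τ := (⌊s / h j⌋₊ : ℝ) * h j
        have hτ0 : 0 ≤ τ := mul_nonneg (Nat.cast_nonneg _) (K.h_pos j).le
        have hτq : |τ * q| ≤ s * M := by
          rw [abs_mul, abs_of_nonneg hτ0]
          exact mul_le_mul (hτle j) (abs_le.2 hq) (abs_nonneg _) hs0.le
        have hy : |x' - τ * q - x| ≤ s * (M + 1) := by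
          rw [abs_le] at hx' hτq ⊢
          constructor <;> linarith
        have g1 := hlin (x' - τ * q - x) (by linarith)
        have g2 := hlin (x' - x) (by nlinarith)
        rw [add_sub_cancel] at g1 g2
        have g3 := mul_le_mul_of_nonneg_left hy he₂.le
        have g4 := mul_le_mul_of_nonneg_left hx' he₂.le
        rw [abs_le] at g1 g2 ⊢
        constructor <;> linarith
    have hz : 0 < δ e * (s / 2) := by positivity
    set z := δ e * (s / 2) with hz_def
    have hzs : z ≤ s := by nlinarith
    have ha : |z| = z := abs_of_pos hz
    have c0 := hcons x (by simpa using hs0.le)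
    have c1 := hcons (x + z) (by simpa [ha] using hzs)
    have c2 := hcons (x + -z) (by simpa [ha] using hzs)
    have l1 := hlin z (by rw [ha]; nlinarith)
    have l2 := hlin (-z) (by rw [abs_neg, ha]; nlinarith)
    rw [abs_neg] at l2
    rw [ha] at l1 l2
    have hez : 2 * (e₂ * (M + 2) * s) + e₂ * z ≤ e * z := by
      have : e * z = e₂ * (4 * (M + 2) + 2) * (s / 2) := by rw [he₂', hz_def]; ring
      rw [this]
      linarith [mul_le_mul_of_nonneg_left hzs he₂.le]
    have := hsc.abs_sub_le H.δ_pos (half_pos hs0) he hp (r := r) hz le_rfl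
      (by rw [abs_le] at *; constructor <;> linarith)
      (by rw [← sub_eq_add_neg] at c2 l2; rw [abs_le] at *; constructor <;> linarith)
    linarith
  rcases lt_or_gt_of_ne hx with hx | hx
  · filter_upwards [key K.refl (neg_lt_neg hx) (hasDerivAt_refl hd)] with s hs p hp
    exact hs p (hasDerivAt_refl hp)
  · exact key K hx hd

end Approx

lemma Prim.ae_differentiableAt {k : ℝ} {A : ℝ → ℝ} (hA : Prim k A) :
    ∀ᵐ x, DifferentiableAt ℝ A x := hA.lipschitz.ae_differentiableAt_real

lemma Prim.deriv_mem {k : ℝ} {A : ℝ → ℝ} (hk : 0 ≤ k) (hA : Prim k A) (x : ℝ) :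
    deriv A x ∈ Icc 0 k := by
  refine ⟨hA.mono.deriv_nonneg, (le_abs_self _).trans ?_⟩
  have := norm_deriv_le_of_lipschitz (x₀ := x) hA.lipschitz
  rwa [Real.coe_toNNReal _ hk] at this

lemma Prim.absolutelyContinuous {k : ℝ} {A : ℝ → ℝ} (hA : Prim k A) (a b : ℝ) :
    AbsolutelyContinuousOnInterval A a b :=
  (hA.lipschitz.lipschitzOnWith (s := uIcc a b)).absolutelyContinuousOnInterval

lemma Prim.integral_deriv {k : ℝ} {A : ℝ → ℝ} (hA : Prim k A) (a b : ℝ) :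
    ∫ x in a..b, deriv A x = A b - A a :=
  (hA.absolutelyContinuous a b).integral_deriv_eq_sub

lemma locallyIntegrable_of_mem_Icc {k : ℝ} {r : ℝ → ℝ} (hr : Measurable r)
    (hk : ∀ x, r x ∈ Icc 0 k) : LocallyIntegrable r :=
  (locallyIntegrable_const k).mono hr.aestronglyMeasurable (Eventually.of_forall fun x => by
    rw [Real.norm_eq_abs, Real.norm_eq_abs, abs_of_nonneg (hk x).1]
    exact (hk x).2.trans (le_abs_self k))

lemma prim_integral {k : ℝ} {r : ℝ → ℝ} (hr : Measurable r) (hk : ∀ x, r x ∈ Icc 0 k) :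
    Prim k fun x => ∫ y in (0 : ℝ)..x, r y := by
  have hi : ∀ a b, IntervalIntegrable r volume a b := fun a b =>
    ((locallyIntegrable_of_mem_Icc hr hk).integrableOn_isCompact
      isCompact_uIcc).intervalIntegrable
  have e : ∀ x y, (∫ z in (0 : ℝ)..y, r z) - ∫ z in (0 : ℝ)..x, r z = ∫ z in x..y, r z :=
    fun x y => intervalIntegral.integral_interval_sub_left (hi 0 y) (hi 0 x)
  refine ⟨fun x y hxy => ?_, fun x y hxy => ?_⟩
  · have h1 := e x y
    have h2 : 0 ≤ ∫ z in x..y, r z := intervalIntegral.integral_nonneg hxy fun z _ => (hk z).1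
    linarith
  · rw [e x y]
    calc ∫ z in x..y, r z ≤ ∫ _ in x..y, k :=
          intervalIntegral.integral_mono_on hxy (hi x y) (by simp) fun z _ => (hk z).2
      _ = k * (y - x) := by rw [intervalIntegral.integral_const, smul_eq_mul, mul_comm]

lemma deriv_eq_zero_of_eqOn {A : ℝ → ℝ} {b c x : ℝ} (h : ∀ y, b ≤ y → A y = c) (hx : b < x) :
    deriv A x = 0 := by
  have : A =ᶠ[𝓝 x] fun _ => c := by
    filter_upwards [Ioi_mem_nhds hx] with y hy using h y (le_of_lt hy)
  rw [this.deriv_eq, deriv_const]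

lemma deriv_refl (A : ℝ → ℝ) (x : ℝ) : deriv (refl A) (-x) = deriv A x := by
  have h1 : deriv (fun y => -A (-y)) (-x) = -deriv (fun y => A (-y)) (-x) := deriv.fun_neg
  have h2 := deriv_comp_neg A (-x)
  rw [neg_neg] at h2
  change deriv (fun y => -A (-y)) (-x) = _
  rw [h1, h2, neg_neg]

namespace Approx

variable {R M L : ℝ} {f g P δ : ℝ → ℝ} {h : ℕ → ℝ} {u : ℕ → ℕ → ℝ → ℝ} {ξ : ℕ → ℕ → ℝ}
  {w : ℝ → ℝ → ℝ} {ζ : ℝ → ℝ}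

lemma tail (K : Approx R M L g h u ξ w ζ) (H : LegendreData R M f g P δ) {b c : ℝ}
    (hξ : ∀ j n, ξ j n ≤ b) (hb : ∀ x, b ≤ x → w 0 x = c) {t x : ℝ} (ht : 0 ≤ t)
    (hx : b + t * M ≤ x) : w t x = c := by
  refine tendsto_nhds_unique (K.lim t x) (tendsto_const_nhds.congr fun j => ?_)
  refine (H.chain_tail (K.h_pos j).le (K.chain j) (hξ j) (by rwa [K.initial j]) _ x ?_).symm
  have h1 := Nat.floor_le (div_nonneg ht (K.h_pos j).le)
  rw [le_div_iff₀ (K.h_pos j)] at h1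
  have := mul_le_mul_of_nonneg_right h1 H.M_pos.le
  linarith

lemma abs_deriv_sub_le (K : Approx R M L g h u ξ w ζ) (H : LegendreData R M f g P δ)
    {t x r ε : ℝ} (ht : 0 ≤ t) (hx : x ≠ ζ t) (hd : HasDerivAt (w t) r x) (hε : 0 < ε) :
    ∀ᶠ s in 𝓝[Ici 0] t, ∀ p, HasDerivAt (w s) p x → |p - r| ≤ ε := by
  rcases ht.eq_or_lt with rfl | ht
  · rw [← Ioi_insert, nhdsWithin_insert, eventually_sup]
    refine ⟨?_, K.abs_deriv_sub_le_of_zero H hx hd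
      (by rw [← hd.deriv]; exact (K.prim 0).deriv_mem H.R_pos.le x) hε⟩
    rw [eventually_pure]
    intro p hp
    rw [hp.unique hd]
    simpa using hε.le
  · exact (K.abs_deriv_sub_le_of_pos H ht hx hd hε).filter_mono nhdsWithin_le_nhds

lemma measurable_density (K : Approx R M L g h u ξ w ζ) :
    Measurable (Function.uncurry fun t x => deriv (w t) x) :=
  measurable_deriv_with_param K.continuous

end Approx

namespace Approx

variable {R M L : ℝ} {f g P δ : ℝ → ℝ} {h : ℕ → ℝ} {u : ℕ → ℕ → ℝ → ℝ} {ξ : ℕ → ℕ → ℝ}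
  {w : ℝ → ℝ → ℝ} {ζ : ℝ → ℝ}

lemma deriv_eq_zero (K : Approx R M L g h u ξ w ζ) (H : LegendreData R M f g P δ) {b c c' : ℝ}
    (hξ : ∀ j n, |ξ j n| ≤ b) (hb : ∀ x, b ≤ x → w 0 x = c) (hb' : ∀ x, x ≤ -b → w 0 x = c')
    {t x : ℝ} (ht : 0 ≤ t) (hx : b + t * M < |x|) : deriv (w t) x = 0 := by
  rcases le_total 0 x with h0 | h0
  · rw [abs_of_nonneg h0] at hx
    exact deriv_eq_zero_of_eqOn (fun y hy =>
      K.tail H (fun j n => (abs_le.1 (hξ j n)).2) hb ht hy) hx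
  · rw [abs_of_nonpos h0] at hx
    rw [← deriv_refl]
    exact deriv_eq_zero_of_eqOn (fun y hy =>
      K.refl.tail H (c := -c') (fun j n => neg_le.1 (abs_le.1 (hξ j n)).1)
        (fun x hx => by rw [Hughes.refl, hb' _ (neg_le_neg hx)]) ht hy) hx

lemma norm_deriv_le_indicator (K : Approx R M L g h u ξ w ζ) (hR : 0 ≤ R)
    {B t : ℝ} (ht : ∀ x, B < |x| → deriv (w t) x = 0) (x : ℝ) :
    |deriv (w t) x| ≤ (Icc (-B) B).indicator (fun _ => R) x := by
  by_cases hx : |x| ≤ B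
  · rw [indicator_of_mem (show x ∈ Icc (-B) B from abs_le.1 hx),
      abs_of_nonneg ((K.prim t).deriv_mem hR x).1]
    exact ((K.prim t).deriv_mem hR x).2
  · rw [ht x (not_le.1 hx), abs_zero]
    exact indicator_nonneg (fun _ _ => hR) x

lemma integrable_indicator_Icc (R B : ℝ) :
    Integrable ((Icc (-B) B).indicator fun _ : ℝ => R) :=
  (integrable_indicator_iff measurableSet_Icc).2 (integrableOn_const (by simp))

lemma integrable_density (K : Approx R M L g h u ξ w ζ) (hR : 0 ≤ R)
    {B t : ℝ} (ht : ∀ x, B < |x| → deriv (w t) x = 0) : Integrable (deriv (w t)) :=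
  (integrable_indicator_Icc R B).mono' (measurable_deriv _).aestronglyMeasurable
    (Eventually.of_forall fun x => K.norm_deriv_le_indicator hR ht x)

lemma tendsto_integral_density (K : Approx R M L g h u ξ w ζ) (H : LegendreData R M f g P δ)
    {b : ℝ} (hsupp : ∀ t, 0 ≤ t → ∀ x, b + t * M < |x| → deriv (w t) x = 0) {s : ℝ} (hs : 0 ≤ s) :
    Tendsto (fun t => ∫ x : ℝ, |deriv (w t) x - deriv (w s) x|) (𝓝[Ici 0] s) (𝓝 0) := by
  refine tendsto_of_seq_tendsto fun a ha => ?_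
  have hM := H.M_pos.le
  have ha2 : Tendsto a atTop (𝓝 s) := tendsto_nhds_of_tendsto_nhdsWithin ha
  have ha1 : ∀ᶠ n in atTop, 0 ≤ a n := tendsto_nhdsWithin_iff.1 ha |>.2
  set B := b + (s + 1) * M with hB
  have hsup2 : ∀ t, 0 ≤ t → t ≤ s + 1 → ∀ x, B < |x| → deriv (w t) x = 0 := fun t h0 h1 x hx =>
    hsupp t h0 x (lt_of_le_of_lt (by linarith [mul_le_mul_of_nonneg_right h1 hM]) hx)
  have key : Tendsto (fun n => ∫ x : ℝ, |deriv (w (a n)) x - deriv (w s) x|) atTop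
      (𝓝 (∫ _ : ℝ, (0 : ℝ))) := by
    refine tendsto_integral_filter_of_dominated_convergence
      (fun x => (Icc (-B) B).indicator (fun _ => R) x + (Icc (-B) B).indicator (fun _ => R) x)
      (Eventually.of_forall fun n =>
        ((measurable_deriv _).sub (measurable_deriv _)).abs.aestronglyMeasurable)
      ?_ ((integrable_indicator_Icc R B).add (integrable_indicator_Icc R B)) ?_
    · filter_upwards [ha1, ha2.eventually (gt_mem_nhds (lt_add_one s))] with n h1 h2
      refine Eventually.of_forall fun x => ?_
      rw [Real.norm_eq_abs, abs_abs]
      exact (abs_sub _ _).trans (add_le_add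
        (K.norm_deriv_le_indicator H.R_pos.le (hsup2 _ h1 h2.le) x)
        (K.norm_deriv_le_indicator H.R_pos.le (hsup2 _ hs (by linarith)) x))
    · have hd := ae_all_iff.2 fun n => (K.prim (a n)).ae_differentiableAt
      filter_upwards [hd, (K.prim s).ae_differentiableAt,
        compl_mem_ae_iff.2 (measure_singleton (ζ s))] with x h1 h2 h3
      rw [Metric.tendsto_nhds]
      intro ε hε
      filter_upwards [ha.eventually (K.abs_deriv_sub_le H hs h3 h2.hasDerivAt (half_pos hε))]
        with n hn
      rw [Real.dist_eq, sub_zero, abs_abs]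
      exact (hn _ (h1 n).hasDerivAt).trans_lt (half_lt_self hε)
  rw [integral_zero] at key
  exact key

end Approx

lemma Prim.cost_balance {α k : ℝ} {A : ℝ → ℝ} (hA : Prim k A) {ξ : ℝ} (hξ : ξ ∈ Ioo (-1 : ℝ) 1)
    (h0 : costGap α A ξ = 0) :
    ∫ y in Ioo (-1 : ℝ) ξ, (1 + α * deriv A y) = ∫ y in Ioo ξ 1, (1 + α * deriv A y) := by
  have key : ∀ a b : ℝ, a ≤ b →
      ∫ y in Ioo a b, (1 + α * deriv A y) = b - a + α * (A b - A a) := by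
    intro a b hab
    rw [← integral_Ioc_eq_integral_Ioo, ← intervalIntegral.integral_of_le hab,
      intervalIntegral.integral_add (by simp)
        ((hA.absolutelyContinuous a b).intervalIntegrable_deriv.const_mul α),
      intervalIntegral.integral_const_mul, hA.integral_deriv]
    simp
  rw [key _ _ hξ.1.le, key _ _ hξ.2.le]
  simp only [costGap] at h0
  linarith

lemma lineDeriv_one (A : ℝ → ℝ) (x : ℝ) : lineDeriv ℝ A x 1 = deriv A x := by
  have := deriv_comp_const_add A x 0
  simpa [lineDeriv] using this

lemma Prim.integral_mul_deriv {k : ℝ} {S ψ : ℝ → ℝ} (hS : Prim k S) (hψ : ContDiff ℝ 1 ψ)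
    (hc : HasCompactSupport ψ) :
    ∫ x, ψ x * deriv S x = -∫ x, deriv ψ x * S x := by
  obtain ⟨C, hC⟩ := hψ.lipschitzWith_of_hasCompactSupport hc one_ne_zero
  have h := LipschitzWith.integral_lineDeriv_mul_eq (μ := volume) hS.lipschitz hC hc 1
  rw [← integral_neg]
  convert h using 3 with x x
  · rw [lineDeriv_one, mul_comm]
  · rw [lineDeriv_neg, lineDeriv_one, neg_mul]

lemma integrable_mul_of_abs_le {E : Type*} [MeasureSpace E] [TopologicalSpace E]
    [OpensMeasurableSpace E] [IsFiniteMeasureOnCompacts (volume : Measure E)]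
    {ψ a : E → ℝ} (hψ : Continuous ψ) (hc : HasCompactSupport ψ)
    (ha : Measurable a) {C : ℝ} (hb : ∀ p, |a p| ≤ C) : Integrable fun p => ψ p * a p :=
  (hψ.integrable_of_hasCompactSupport hc).mul_bdd ha.aestronglyMeasurable
    (Eventually.of_forall hb)

/-- The primitive of the density of `A` truncated at `k`. -/
def trunc (k : ℝ) (A : ℝ → ℝ) (x : ℝ) : ℝ := ∫ y in (0 : ℝ)..x, min (deriv A y) k

section Trunc

variable {R k : ℝ} {A : ℝ → ℝ}

lemma measurable_min_deriv (A : ℝ → ℝ) (k : ℝ) : Measurable fun y => min (deriv A y) k :=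
  (measurable_deriv A).min measurable_const

lemma Prim.min_deriv_mem (hA : Prim R A) (hk : k ∈ Icc 0 R) (y : ℝ) :
    min (deriv A y) k ∈ Icc 0 k :=
  ⟨le_min (hA.deriv_mem (hk.1.trans hk.2) y).1 hk.1, min_le_right _ _⟩

lemma Prim.trunc (hA : Prim R A) (hk : k ∈ Icc 0 R) : Prim k (trunc k A) :=
  prim_integral (measurable_min_deriv A k) (hA.min_deriv_mem hk)

lemma Prim.intervalIntegrable_min_deriv (hA : Prim R A) (hk : k ∈ Icc 0 R) (a b : ℝ) :
    IntervalIntegrable (fun y => min (deriv A y) k) volume a b :=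
  ((locallyIntegrable_of_mem_Icc (measurable_min_deriv A k)
    (hA.min_deriv_mem hk)).integrableOn_isCompact isCompact_uIcc).intervalIntegrable

lemma Prim.trunc_sub (hA : Prim R A) (hk : k ∈ Icc 0 R) (x y : ℝ) :
    Hughes.trunc k A y - Hughes.trunc k A x = ∫ z in x..y, min (deriv A z) k :=
  intervalIntegral.integral_interval_sub_left (hA.intervalIntegrable_min_deriv hk 0 y)
    (hA.intervalIntegrable_min_deriv hk 0 x)

lemma Prim.monotone_sub_trunc (hA : Prim R A) (hk : k ∈ Icc 0 R) :
    Monotone fun x => A x - Hughes.trunc k A x := by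
  intro x y hxy
  have h1 := hA.trunc_sub hk x y
  have h2 := hA.integral_deriv x y
  have h3 := intervalIntegral.integral_mono_on hxy (hA.intervalIntegrable_min_deriv hk x y)
    (hA.absolutelyContinuous x y).intervalIntegrable_deriv fun z _ => min_le_left (deriv A z) k
  change A x - Hughes.trunc k A x ≤ A y - Hughes.trunc k A y
  linarith

lemma Prim.ae_deriv_trunc (hA : Prim R A) (hk : k ∈ Icc 0 R) :
    ∀ᵐ x, deriv (Hughes.trunc k A) x = min (deriv A x) k := by
  filter_upwards [LocallyIntegrable.ae_hasDerivAt_integral (locallyIntegrable_of_mem_Icc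
    (measurable_min_deriv A k) (hA.min_deriv_mem hk))] with x hx
  exact (hx 0).deriv

lemma Prim.trunc_self (hA : Prim R A) (hR : 0 ≤ R) : Hughes.trunc R A = fun x => A x - A 0 := by
  ext x
  rw [Hughes.trunc, ← hA.integral_deriv]
  exact intervalIntegral.integral_congr fun y _ => min_eq_left (hA.deriv_mem hR y).2

end Trunc

namespace LegendreData

variable {R M k h : ℝ} {f g P δ A : ℝ → ℝ}

lemma deriv_step_trunc_le (H : LegendreData R M f g P δ) (hh : 0 < h) (hA : Prim R A)
    (hk : k ∈ Icc 0 R) (ξ : ℝ) :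
    ∀ᵐ x, deriv (step M g h ξ (trunc k A)) x ≤ min (deriv (step M g h ξ A) x) k := by
  have h1 := H.step_prim hh H.R_pos.le le_rfl hA ξ
  have h2 := H.step_prim hh hk.1 hk.2 (hA.trunc hk) ξ
  filter_upwards [h1.ae_differentiableAt, h2.ae_differentiableAt] with x d1 d2
  refine le_min ?_ (h2.deriv_mem hk.1 x).2
  have := (H.step_order hh ((hA.trunc hk).weaken hk.2) hA (hA.monotone_sub_trunc hk) ξ).deriv_nonneg
    (x := x)
  rw [deriv_fun_sub d1 d2] at this
  linarith

lemma deriv_step_trunc_self (H : LegendreData R M f g P δ) (hh : 0 < h) (hA : Prim R A)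
    (ξ x : ℝ) :
    deriv (step M g h ξ (trunc R A)) x = min (deriv (step M g h ξ A) x) R := by
  rw [min_eq_left ((H.step_prim hh H.R_pos.le le_rfl hA ξ).deriv_mem H.R_pos.le x).2,
    hA.trunc_self H.R_pos.le, funext (H.step_sub_const hA ξ (A 0)), deriv_sub_const]

lemma slice_eq (H : LegendreData R M f g P δ) (hh : 0 < h) (hA : Prim R A) (hk : k ∈ Icc 0 R)
    (ξ : ℝ) {ψ : ℝ → ℝ} (hψ : ContDiff ℝ 1 ψ) (hc : HasCompactSupport ψ) :
    ∫ x, (ψ x * (min (deriv (step M g h ξ A) x) k - min (deriv A x) k)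
      + deriv ψ x * (step M g h ξ (trunc k A) x - trunc k A x)) =
    ∫ x, ψ x * (min (deriv (step M g h ξ A) x) k - deriv (step M g h ξ (trunc k A)) x) := by
  have hT := hA.trunc hk
  have hS := H.step_prim hh hk.1 hk.2 hT ξ
  have hA' := H.step_prim hh H.R_pos.le le_rfl hA ξ
  have hbd : ∀ {r : ℝ → ℝ}, (∀ x, r x ∈ Icc 0 k) → ∀ x, |r x| ≤ k := fun hr x => by
    rw [abs_of_nonneg (hr x).1]; exact (hr x).2
  have i1 := integrable_mul_of_abs_le hψ.continuous hc (measurable_min_deriv (step M g h ξ A) k)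
    (hbd (hA'.min_deriv_mem hk))
  have i2 := integrable_mul_of_abs_le hψ.continuous hc (measurable_min_deriv A k)
    (hbd (hA.min_deriv_mem hk))
  have i3 := integrable_mul_of_abs_le hψ.continuous hc (measurable_deriv _)
    (hbd (hS.deriv_mem hk.1))
  have hψ' := hψ.continuous_deriv le_rfl
  have i4 : Integrable fun x => deriv ψ x * step M g h ξ (trunc k A) x :=
    (hψ'.mul hS.continuous).integrable_of_hasCompactSupport hc.deriv.mul_right
  have i5 : Integrable fun x => deriv ψ x * trunc k A x :=
    (hψ'.mul hT.continuous).integrable_of_hasCompactSupport hc.deriv.mul_right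
  have e1 := hS.integral_mul_deriv hψ hc
  have e2 := hT.integral_mul_deriv hψ hc
  have e3 : ∫ x, ψ x * deriv (trunc k A) x = ∫ x, ψ x * min (deriv A x) k := by
    refine integral_congr_ae ?_
    filter_upwards [hA.ae_deriv_trunc hk] with x hx
    rw [hx]
  simp only [mul_sub]
  rw [integral_add (by exact i1.sub i2) (by exact i4.sub i5), integral_sub i1 i2,
    integral_sub i4 i5,
    integral_sub i1 i3]
  linarith

lemma slice_nonneg (H : LegendreData R M f g P δ) (hh : 0 < h) (hA : Prim R A)
    (hk : k ∈ Icc 0 R) (ξ : ℝ) {ψ : ℝ → ℝ} (hψ : ContDiff ℝ 1 ψ) (hc : HasCompactSupport ψ)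
    (h0 : ∀ x, 0 ≤ ψ x) :
    0 ≤ ∫ x, (ψ x * (min (deriv (step M g h ξ A) x) k - min (deriv A x) k)
      + deriv ψ x * (step M g h ξ (trunc k A) x - trunc k A x)) := by
  rw [H.slice_eq hh hA hk ξ hψ hc]
  refine integral_nonneg_of_ae ?_
  filter_upwards [H.deriv_step_trunc_le hh hA hk ξ] with x hx
  exact mul_nonneg (h0 x) (sub_nonneg.2 hx)

lemma slice_self (H : LegendreData R M f g P δ) (hh : 0 < h) (hA : Prim R A)
    (ξ : ℝ) {ψ : ℝ → ℝ} (hψ : ContDiff ℝ 1 ψ) (hc : HasCompactSupport ψ) :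
    ∫ x, (ψ x * (min (deriv (step M g h ξ A) x) R - min (deriv A x) R)
      + deriv ψ x * (step M g h ξ (trunc R A) x - trunc R A x)) = 0 := by
  rw [H.slice_eq hh hA H.R_mem ξ hψ hc]
  simp [H.deriv_step_trunc_self hh hA]

end LegendreData

/-- The truncated density of a run of the scheme, as a function of time and space. -/
def density (h k : ℝ) (u : ℕ → ℝ → ℝ) (p : ℝ × ℝ) : ℝ := min (deriv (u ⌊p.1 / h⌋₊) p.2) k

/-- The amount of truncated density crossing `p.2` in one step of a run of the scheme. -/
def crossing (M : ℝ) (g : ℝ → ℝ) (h k : ℝ) (u : ℕ → ℝ → ℝ) (ξ : ℕ → ℝ) (p : ℝ × ℝ) : ℝ :=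
  step M g h (ξ ⌊p.1 / h⌋₊) (trunc k (u ⌊p.1 / h⌋₊)) p.2 - trunc k (u ⌊p.1 / h⌋₊) p.2

lemma hasDerivAt_slice {φ : ℝ × ℝ → ℝ} (hφ : ContDiff ℝ 1 φ) (t x : ℝ) :
    HasDerivAt (fun x => φ (t, x)) (fderiv ℝ φ (t, x) (0, 1)) x :=
  ((hφ.differentiable one_ne_zero) (t, x)).hasFDerivAt.comp_hasDerivAt x
    ((hasDerivAt_const x t).prodMk (hasDerivAt_id x))

lemma hasDerivAt_slice_left {φ : ℝ × ℝ → ℝ} (hφ : ContDiff ℝ 1 φ) (t x : ℝ) :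
    HasDerivAt (fun t => φ (t, x)) (fderiv ℝ φ (t, x) (1, 0)) t :=
  ((hφ.differentiable one_ne_zero) (t, x)).hasFDerivAt.comp_hasDerivAt t
    ((hasDerivAt_id t).prodMk (hasDerivAt_const t x))

lemma hasCompactSupport_slice {φ : ℝ × ℝ → ℝ} (hc : HasCompactSupport φ) (t : ℝ) :
    HasCompactSupport fun x => φ (t, x) :=
  HasCompactSupport.intro (hc.isCompact.image continuous_snd) fun _ hx =>
    image_eq_zero_of_notMem_tsupport fun h => hx ⟨_, h, rfl⟩

lemma hasCompactSupport_slice_left {φ : ℝ × ℝ → ℝ} (hc : HasCompactSupport φ) (x : ℝ) :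
    HasCompactSupport fun t => φ (t, x) :=
  HasCompactSupport.intro (hc.isCompact.image continuous_fst) fun _ ht =>
    image_eq_zero_of_notMem_tsupport fun h => ht ⟨_, h, rfl⟩

lemma continuous_partial {φ : ℝ × ℝ → ℝ} (hφ : ContDiff ℝ 1 φ) (e : ℝ × ℝ) :
    Continuous fun p => fderiv ℝ φ p e :=
  (hφ.continuous_fderiv one_ne_zero).clm_apply continuous_const

lemma hasCompactSupport_partial {φ : ℝ × ℝ → ℝ} (hc : HasCompactSupport φ) (e : ℝ × ℝ) :
    HasCompactSupport fun p => fderiv ℝ φ p e :=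
  (hc.fderiv (𝕜 := ℝ)).comp_left (g := fun l : ℝ × ℝ →L[ℝ] ℝ => l e) rfl

namespace Chain

variable {R M k h : ℝ} {f g P δ : ℝ → ℝ} {u : ℕ → ℝ → ℝ} {ξ : ℕ → ℝ}

lemma density_mem (hu : Chain R M g h u ξ) (hk : k ∈ Icc 0 R) (p : ℝ × ℝ) :
    density h k u p ∈ Icc 0 k :=
  (hu.prim _).min_deriv_mem hk _

lemma abs_density_le (hu : Chain R M g h u ξ) (hk : k ∈ Icc 0 R) (p : ℝ × ℝ) :
    |density h k u p| ≤ k := by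
  have := hu.density_mem hk p
  rw [abs_of_nonneg this.1]
  exact this.2

lemma measurable_floor_div (h : ℝ) : Measurable fun p : ℝ × ℝ => (⌊p.1 / h⌋₊, p.2) :=
  (Nat.measurable_floor.comp (measurable_fst.div_const h)).prodMk measurable_snd

lemma measurable_density (h k : ℝ) (u : ℕ → ℝ → ℝ) : Measurable (density h k u) :=
  (measurable_from_prod_countable_right (f := fun q : ℕ × ℝ => min (deriv (u q.1) q.2) k)
    fun n => measurable_min_deriv (u n) k).comp (measurable_floor_div h)

lemma measurable_crossing (hu : Chain R M g h u ξ) (H : LegendreData R M f g P δ) (hh : 0 < h)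
    (hk : k ∈ Icc 0 R) : Measurable (crossing M g h k u ξ) := by
  have hF : ∀ n, Measurable fun x => step M g h (ξ n) (trunc k (u n)) x - trunc k (u n) x := by
    intro n
    have h1 := (hu.prim n).trunc hk
    exact (H.step_prim hh hk.1 hk.2 h1 (ξ n)).continuous.measurable.sub h1.continuous.measurable
  have h2 := (measurable_from_prod_countable_right
    (f := fun q : ℕ × ℝ => step M g h (ξ q.1) (trunc k (u q.1)) q.2 - trunc k (u q.1) q.2)
    hF).comp (measurable_floor_div h)
  simp only [Function.comp_def] at h2
  unfold crossing
  exact h2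

lemma abs_crossing_le (hu : Chain R M g h u ξ) (H : LegendreData R M f g P δ) (hh : 0 < h)
    (hk : k ∈ Icc 0 R) (p : ℝ × ℝ) : |crossing M g h k u ξ p| ≤ h * g 0 :=
  H.abs_step_sub_le hh.le (((hu.prim _).trunc hk).weaken hk.2) _ _

lemma density_shift (hu : Chain R M g h u ξ) (hh : 0 < h) {p : ℝ × ℝ} (hp : 0 ≤ p.1) :
    density h k u (p + (h, 0)) =
      min (deriv (step M g h (ξ ⌊p.1 / h⌋₊) (u ⌊p.1 / h⌋₊)) p.2) k := by
  have e : (p.1 + h) / h = p.1 / h + 1 := by field_simp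
  simp only [density, Prod.fst_add, Prod.snd_add, add_zero, e,
    Nat.floor_add_one (div_nonneg hp hh.le), hu.succ]

lemma integral_eq (hu : Chain R M g h u ξ) (H : LegendreData R M f g P δ) (hh : 0 < h)
    (hk : k ∈ Icc 0 R) {φ : ℝ × ℝ → ℝ} (hφ : ContDiff ℝ 1 φ) (hc : HasCompactSupport φ) :
    ∫ p : ℝ × ℝ, (density h k u p * (φ (p - (h, 0)) - φ p)
      + fderiv ℝ φ p (0, 1) * crossing M g h k u ξ p) =
    ∫ t : ℝ, ∫ x : ℝ, (φ (t, x) * (density h k u ((t, x) + (h, 0)) - density h k u (t, x))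
      + deriv (fun x => φ (t, x)) x * crossing M g h k u ξ (t, x)) := by
  have hm := measurable_density h k u
  have hb := hu.abs_density_le hk
  have i1 : Integrable fun p => φ p * density h k u p :=
    integrable_mul_of_abs_le hφ.continuous hc hm hb
  have i2 : Integrable fun p => φ p * density h k u (p + (h, 0)) :=
    integrable_mul_of_abs_le hφ.continuous hc (hm.comp (measurable_add_const _)) fun p => hb _
  have i3 : Integrable fun p => fderiv ℝ φ p (0, 1) * crossing M g h k u ξ p :=
    integrable_mul_of_abs_le (continuous_partial hφ _) (hasCompactSupport_partial hc _)
      (hu.measurable_crossing H hh hk) (hu.abs_crossing_le H hh hk)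
  have i4 : Integrable fun p => φ (p - (h, 0)) * density h k u p := by
    simpa using i2.comp_sub_right (h, 0)
  have e1 : ∫ p, φ (p - (h, 0)) * density h k u p = ∫ p, φ p * density h k u (p + (h, 0)) := by
    have := integral_sub_right_eq_self (μ := volume)
      (fun p => φ p * density h k u (p + (h, 0))) (h, 0)
    simpa only [sub_add_cancel] using this
  calc _ = ∫ p : ℝ × ℝ, (φ p * (density h k u (p + (h, 0)) - density h k u p)
      + fderiv ℝ φ p (0, 1) * crossing M g h k u ξ p) := by
        simp only [mul_sub, mul_comm (density h k u _) (φ _)]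
        rw [integral_add (by exact i4.sub i1) i3, integral_sub i4 i1, e1, ← integral_sub i2 i1,
          ← integral_add (by exact i2.sub i1) i3]
    _ = _ := by
        rw [Measure.volume_eq_prod, integral_prod]
        · simp only [(hasDerivAt_slice hφ _ _).deriv]
        · simp only [mul_sub]
          exact (i2.sub i1).add i3

lemma integral_nonneg (hu : Chain R M g h u ξ) (H : LegendreData R M f g P δ) (hh : 0 < h)
    (hk : k ∈ Icc 0 R) {φ : ℝ × ℝ → ℝ} (hφ : ContDiff ℝ 1 φ) (hc : HasCompactSupport φ)
    (h0 : ∀ p : ℝ × ℝ, p.1 ≤ 0 → φ p = 0) (hp : ∀ p, 0 ≤ φ p) :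
    0 ≤ ∫ p : ℝ × ℝ, (density h k u p * (φ (p - (h, 0)) - φ p)
      + fderiv ℝ φ p (0, 1) * crossing M g h k u ξ p) := by
  rw [hu.integral_eq H hh hk hφ hc]
  refine MeasureTheory.integral_nonneg fun t => ?_
  rcases le_total t 0 with ht | ht
  · simp [h0 (t, _) ht]
  · simp only [hu.density_shift hh (p := (t, _)) ht]
    exact H.slice_nonneg hh (hu.prim _) hk _ (hφ.comp (contDiff_const.prodMk contDiff_id))
      (hasCompactSupport_slice hc t) fun x => hp _

lemma integral_eq_zero (hu : Chain R M g h u ξ) (H : LegendreData R M f g P δ) (hh : 0 < h)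
    {φ : ℝ × ℝ → ℝ} (hφ : ContDiff ℝ 1 φ) (hc : HasCompactSupport φ)
    (h0 : ∀ p : ℝ × ℝ, p.1 ≤ 0 → φ p = 0) :
    ∫ p : ℝ × ℝ, (density h R u p * (φ (p - (h, 0)) - φ p)
      + fderiv ℝ φ p (0, 1) * crossing M g h R u ξ p) = 0 := by
  rw [hu.integral_eq H hh H.R_mem hφ hc]
  refine integral_eq_zero_of_ae (Eventually.of_forall fun t => ?_)
  rcases le_total t 0 with ht | ht
  · simp [h0 (t, _) ht]
  · simp only [hu.density_shift hh (p := (t, _)) ht]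
    exact H.slice_self hh (hu.prim _) _ (hφ.comp (contDiff_const.prodMk contDiff_id))
      (hasCompactSupport_slice hc t)

end Chain

lemma Prim.trunc_consistent {R k r x η e z : ℝ} {A : ℝ → ℝ} (hA : Prim R A) (hk : k ∈ Icc 0 R)
    (hb : ∀ y, |y - x| ≤ η → ∀ p, HasDerivAt A p y → |p - r| ≤ e) (hz : |z| ≤ η) :
    |Hughes.trunc k A (x + z) - Hughes.trunc k A x - min r k * z| ≤ e * |z| := by
  have e1 : Hughes.trunc k A (x + z) - Hughes.trunc k A x - min r k * z =
      ∫ y in x..x + z, (min (deriv A y) k - min r k) := by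
    rw [intervalIntegral.integral_sub (hA.intervalIntegrable_min_deriv hk _ _) (by simp),
      hA.trunc_sub hk, intervalIntegral.integral_const, smul_eq_mul]
    ring
  have h1 := intervalIntegral.norm_integral_le_of_norm_le_const_ae (a := x) (b := x + z) (C := e)
    (f := fun y => min (deriv A y) k - min r k) (by
      filter_upwards [hA.ae_differentiableAt] with y hy hy'
      have h2 : |y - x| ≤ |z| := by
        have := abs_sub_left_of_mem_uIcc (uIoc_subset_uIcc hy')
        simpa using this
      have h3 := abs_min_sub_min_le_max (deriv A y) k r k
      have h4 := hb y (h2.trans hz) _ hy.hasDerivAt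
      rw [sub_self, abs_zero] at h3
      exact h3.trans (max_le h4 ((abs_nonneg _).trans h4)))
  rw [e1]
  simpa using h1

namespace Approx

variable {R M L k t x r : ℝ} {f g P δ : ℝ → ℝ} {h : ℕ → ℝ} {u : ℕ → ℕ → ℝ → ℝ} {ξ : ℕ → ℕ → ℝ}
  {w : ℝ → ℝ → ℝ} {ζ : ℝ → ℝ}

lemma tendsto_density (K : Approx R M L g h u ξ w ζ) (H : LegendreData R M f g P δ)
    (ht : 0 < t) (hx : x ≠ ζ t) (hd : HasDerivAt (w t) r x)
    (hu : ∀ j n, DifferentiableAt ℝ (u j n) x) (k : ℝ) :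
    Tendsto (fun j => density (h j) k (u j) (t, x)) atTop (𝓝 (min r k)) := by
  rw [Metric.tendsto_nhds]
  intro ε hε
  obtain ⟨η, hη, hj⟩ := K.eventually_abs_deriv_sub_le H ht hx hd (half_pos hε)
  filter_upwards [hj] with j hj
  have h1 := hj x (by simpa using hη.le) _ (hu j _).hasDerivAt
  have h2 := abs_min_sub_min_le_max (deriv (u j ⌊t / h j⌋₊) x) k r k
  rw [sub_self, abs_zero] at h2
  exact (h2.trans (max_le h1 (half_pos hε).le)).trans_lt (half_lt_self hε)

lemma tendsto_crossing (K : Approx R M L g h u ξ w ζ) (H : LegendreData R M f g P δ)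
    (ht : 0 < t) (hx : x ≠ ζ t) (hd : HasDerivAt (w t) r x) (hk : k ∈ Icc 0 R) :
    Tendsto (fun j => crossing M g (h j) k (u j) (ξ j) (t, x) / h j) atTop
      (𝓝 (-(Real.sign (x - ζ t) * f (min r k)))) := by
  have hM := H.M_pos
  have hr : min r k ∈ Icc 0 R := by
    have := (K.prim t).min_deriv_mem hk x
    rw [hd.deriv] at this
    exact ⟨this.1, this.2.trans hk.2⟩
  have hhM : Tendsto (fun j => h j * M) atTop (𝓝 0) := by simpa using K.h_lim.mul_const M
  rw [Metric.tendsto_nhds]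
  intro ε hε
  obtain ⟨η, hη, hj⟩ := K.eventually_abs_deriv_sub_le H ht hx hd
    (show 0 < ε / (2 * M) by positivity)
  have hside : ∀ᶠ j in atTop,
      (Real.sign (x - ζ t) = 1 ∧ ξ j ⌊t / h j⌋₊ + h j * M ≤ x) ∨
      (Real.sign (x - ζ t) = -1 ∧ x ≤ ξ j ⌊t / h j⌋₊ - h j * M) := by
    rcases lt_or_gt_of_ne hx with hx | hx
    · have h1 := (K.xi_lim t).sub hhM
      rw [sub_zero] at h1
      filter_upwards [h1.eventually (lt_mem_nhds hx)] with j hj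
      exact Or.inr ⟨Real.sign_of_neg (sub_neg.2 hx), hj.le⟩
    · have h1 := (K.xi_lim t).add hhM
      rw [add_zero] at h1
      filter_upwards [h1.eventually (gt_mem_nhds hx)] with j hj
      exact Or.inl ⟨Real.sign_of_pos (sub_pos.2 hx), hj.le⟩
  filter_upwards [hj, hhM.eventually (gt_mem_nhds hη), hside] with j hj hjM hs
  have hh := K.h_pos j
  have hA := (K.chain j).prim ⌊t / h j⌋₊
  have hT := (hA.trunc hk).weaken hk.2
  have hcons : ∀ q ∈ Icc (-M) M, |trunc k (u j ⌊t / h j⌋₊) (x - h j * q)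
      - trunc k (u j ⌊t / h j⌋₊) x + h j * q * min r k| ≤ ε / (2 * M) * (h j * M) := by
    intro q hq
    have hz : |-(h j * q)| ≤ h j * M := by
      rw [abs_neg, abs_mul, abs_of_pos hh]
      exact mul_le_mul_of_nonneg_left (abs_le.2 hq) hh.le
    have h1 := hA.trunc_consistent (r := r) (x := x) (z := -(h j * q)) hk hj (hz.trans hjM.le)
    refine le_trans (le_of_eq ?_) (h1.trans (mul_le_mul_of_nonneg_left hz (by positivity)))
    congr 1
    rw [← sub_eq_add_neg]
    ring
  have hε2 : ε / (2 * M) * (h j * M) = ε / 2 * h j := by field_simp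
  rw [hε2] at hcons
  have hfin : |crossing M g (h j) k (u j) (ξ j) (t, x)
      + h j * (Real.sign (x - ζ t) * f (min r k))| ≤ ε / 2 * h j := by
    rcases hs with ⟨hs, hs'⟩ | ⟨hs, hs'⟩
    · rw [hs, one_mul]
      exact H.step_consistent hh.le hT hr hs' hcons
    · rw [hs, neg_one_mul, mul_neg, ← sub_eq_add_neg]
      exact H.step_consistent_left hh.le hT hr hs' hcons
  rw [Real.dist_eq, sub_neg_eq_add]
  have e2 : crossing M g (h j) k (u j) (ξ j) (t, x) / h j + Real.sign (x - ζ t) * f (min r k) =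
      (crossing M g (h j) k (u j) (ξ j) (t, x) + h j * (Real.sign (x - ζ t) * f (min r k)))
        / h j := by
    field_simp
  rw [e2, abs_div, abs_of_pos hh, div_lt_iff₀ hh]
  refine hfin.trans_lt ?_
  nlinarith

lemma tendsto_shift_div (K : Approx R M L g h u ξ w ζ) {φ : ℝ × ℝ → ℝ} (hφ : ContDiff ℝ 1 φ)
    (t x : ℝ) :
    Tendsto (fun j => (φ ((t, x) - (h j, 0)) - φ (t, x)) / h j) atTop
      (𝓝 (-fderiv ℝ φ (t, x) (1, 0))) := by
  have h1 := (hasDerivAt_slice_left hφ t x).tendsto_slope_zero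
  have h2 : Tendsto (fun j => -h j) atTop (𝓝[≠] 0) :=
    tendsto_nhdsWithin_iff.2 ⟨by simpa using K.h_lim.neg,
      Eventually.of_forall fun j => neg_ne_zero.2 (K.h_pos j).ne'⟩
  refine (h1.comp h2).neg.congr fun j => ?_
  simp only [Function.comp_def, Prod.mk_sub_mk, sub_zero, smul_eq_mul, ← sub_eq_add_neg]
  rw [inv_neg, neg_mul, neg_neg, inv_mul_eq_div]

lemma continuous_interface (K : Approx R M L g h u ξ w ζ) : Continuous ζ := by
  refine (LipschitzWith.of_dist_le_mul (K := L.toNNReal) fun s t => ?_).continuous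
  rw [Real.coe_toNNReal _ K.L_nonneg]
  exact K.xi_abs_sub_le t s

end Approx

lemma measurable_sign : Measurable Real.sign := by
  unfold Real.sign
  exact Measurable.ite measurableSet_Iio measurable_const
    (Measurable.ite measurableSet_Ioi measurable_const measurable_const)

lemma measurable_comp_of_continuousOn {E : Type*} [MeasurableSpace E] {a b : ℝ} {f : ℝ → ℝ}
    (hf : ContinuousOn f (Icc a b)) {r : E → ℝ} (hr : Measurable r) (h : ∀ p, r p ∈ Icc a b) :
    Measurable fun p => f (r p) :=
  (continuousOn_iff_continuous_domRestrict.1 hf).measurable.comp (hr.subtype_mk (h := h))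

lemma ae_tendsto_prod {F : ℕ → ℝ × ℝ → ℝ} {G : ℝ × ℝ → ℝ} (hF : ∀ j, Measurable (F j))
    (hG : Measurable G)
    (h : ∀ t, ∀ᵐ x, Tendsto (fun j => F j (t, x)) atTop (𝓝 (G (t, x)))) :
    ∀ᵐ p : ℝ × ℝ, Tendsto (fun j => F j p) atTop (𝓝 (G p)) := by
  have hm : MeasurableSet {p : ℝ × ℝ | Tendsto (fun j => F j p - G p) atTop (𝓝 0)} :=
    measurableSet_tendsto _ fun j => (hF j).sub hG
  have h0 : volume {p : ℝ × ℝ | Tendsto (fun j => F j p - G p) atTop (𝓝 0)}ᶜ = 0 := by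
    rw [Measure.volume_eq_prod]
    refine Measure.measure_prod_null_of_ae_null hm.compl (Eventually.of_forall fun t => ?_)
    have h1 : ∀ᵐ x, (t, x) ∈ {p : ℝ × ℝ | Tendsto (fun j => F j p - G p) atTop (𝓝 0)} := by
      filter_upwards [h t] with x hx using tendsto_sub_nhds_zero_iff.2 hx
    exact h1
  filter_upwards [measure_eq_zero_iff_ae_notMem.1 h0] with p hp
  exact tendsto_sub_nhds_zero_iff.1 (not_not.1 hp)

lemma fderiv_eq_zero_of_nonpos {φ : ℝ × ℝ → ℝ} (h0 : ∀ p : ℝ × ℝ, p.1 ≤ 0 → φ p = 0)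
    (hp : ∀ p, 0 ≤ φ p) {p : ℝ × ℝ} (h : p.1 ≤ 0) : fderiv ℝ φ p = 0 :=
  IsLocalMin.fderiv_eq_zero (Eventually.of_forall fun q => (h0 p h).trans_le (hp q))

lemma exists_support_bound {φ : ℝ × ℝ → ℝ} (hφ : ContDiff ℝ 1 φ) (hc : HasCompactSupport φ) :
    ∃ C B : ℝ, 0 ≤ C ∧ (∀ p q, |φ p - φ q| ≤ C * ‖p - q‖) ∧ (∀ p, |fderiv ℝ φ p (0, 1)| ≤ C) ∧
      ∀ p, B < ‖p‖ → φ p = 0 ∧ fderiv ℝ φ p = 0 := by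
  obtain ⟨C, hC⟩ := hφ.lipschitzWith_of_hasCompactSupport hc one_ne_zero
  obtain ⟨B, hB⟩ := hc.isCompact.isBounded.subset_closedBall 0
  refine ⟨C, B, C.2, fun p q => ?_, fun p => ?_, fun p hp => ?_⟩
  · rw [← dist_eq_norm, ← Real.dist_eq]
    exact hC.dist_le_mul p q
  · have h1 := (fderiv ℝ φ p).le_opNorm (0, 1)
    have h2 := norm_fderiv_le_of_lipschitz ℝ (x₀ := p) hC
    have h3 : ‖((0 : ℝ), (1 : ℝ))‖ = 1 := by simp [Prod.norm_def]
    rw [h3, mul_one] at h1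
    exact h1.trans h2
  · have h1 : p ∉ tsupport φ := fun h => by
      have := hB h
      rw [mem_closedBall_zero_iff] at this
      linarith
    exact ⟨image_eq_zero_of_notMem_tsupport h1, fderiv_of_notMem_tsupport ℝ h1⟩

namespace Approx

variable {R M L k : ℝ} {f g P δ : ℝ → ℝ} {h : ℕ → ℝ} {u : ℕ → ℕ → ℝ → ℝ} {ξ : ℕ → ℕ → ℝ}
  {w : ℝ → ℝ → ℝ} {ζ : ℝ → ℝ} {φ : ℝ × ℝ → ℝ}

lemma density_mem (K : Approx R M L g h u ξ w ζ) (hk : k ∈ Icc 0 R) (p : ℝ × ℝ) :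
    min (deriv (w p.1) p.2) k ∈ Icc 0 k :=
  (K.prim _).min_deriv_mem hk _

lemma measurable_min_density (K : Approx R M L g h u ξ w ζ) (k : ℝ) :
    Measurable fun p : ℝ × ℝ => min (deriv (w p.1) p.2) k :=
  K.measurable_density.min measurable_const

lemma measurable_sign_interface (K : Approx R M L g h u ξ w ζ) :
    Measurable fun p : ℝ × ℝ => Real.sign (p.2 - ζ p.1) :=
  measurable_sign.comp
    (measurable_snd.sub (K.continuous_interface.measurable.comp measurable_fst))

lemma measurable_flux (K : Approx R M L g h u ξ w ζ) (H : LegendreData R M f g P δ)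
    (hk : k ∈ Icc 0 R) :
    Measurable fun p : ℝ × ℝ =>
      Real.sign (p.2 - ζ p.1) * f (min (deriv (w p.1) p.2) k) :=
  K.measurable_sign_interface.mul (measurable_comp_of_continuousOn H.f_cont
    (K.measurable_min_density k)
    fun p => ⟨(K.density_mem hk p).1, (K.density_mem hk p).2.trans hk.2⟩)

lemma tendsto_integral (K : Approx R M L g h u ξ w ζ) (H : LegendreData R M f g P δ)
    (hk : k ∈ Icc 0 R) (hφ : ContDiff ℝ 1 φ) (hc : HasCompactSupport φ)
    (h0 : ∀ p : ℝ × ℝ, p.1 ≤ 0 → φ p = 0) (hp : ∀ p, 0 ≤ φ p) :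
    Tendsto (fun j => (∫ p : ℝ × ℝ, (density (h j) k (u j) p * (φ (p - (h j, 0)) - φ p)
        + fderiv ℝ φ p (0, 1) * crossing M g (h j) k (u j) (ξ j) p)) / h j) atTop
      (𝓝 (-∫ p : ℝ × ℝ, (min (deriv (w p.1) p.2) k * fderiv ℝ φ p (1, 0)
        + Real.sign (p.2 - ζ p.1) * f (min (deriv (w p.1) p.2) k) * fderiv ℝ φ p (0, 1)))) := by
  obtain ⟨C, B, hC, hlip, hder, hsupp⟩ := exists_support_bound hφ hc
  simp only [← integral_div, ← integral_neg]
  have hmF : ∀ j, Measurable fun p : ℝ × ℝ =>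
      (density (h j) k (u j) p * (φ (p - (h j, 0)) - φ p)
        + fderiv ℝ φ p (0, 1) * crossing M g (h j) k (u j) (ξ j) p) / h j := fun j =>
    (((Chain.measurable_density (h j) k (u j)).mul
      ((hφ.continuous.comp (continuous_id.sub continuous_const)).sub hφ.continuous).measurable).add
      ((continuous_partial hφ _).measurable.mul
        ((K.chain j).measurable_crossing H (K.h_pos j) hk))).div_const _
  have hmG : Measurable fun p : ℝ × ℝ => -(min (deriv (w p.1) p.2) k * fderiv ℝ φ p (1, 0)
      + Real.sign (p.2 - ζ p.1) * f (min (deriv (w p.1) p.2) k) * fderiv ℝ φ p (0, 1)) :=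
    (((K.measurable_min_density k).mul (continuous_partial hφ _).measurable).add
      ((K.measurable_flux H hk).mul (continuous_partial hφ _).measurable)).neg
  refine tendsto_integral_filter_of_dominated_convergence
    ((Metric.closedBall 0 (B + 1)).indicator fun _ => k * C + C * g 0)
    (Eventually.of_forall fun j => (hmF j).aestronglyMeasurable) ?_ ?_
    (ae_tendsto_prod hmF hmG fun t => ?_)
  · filter_upwards [K.h_lim.eventually (gt_mem_nhds one_pos)] with j hj
    refine Eventually.of_forall fun p => ?_
    have hh := K.h_pos j
    have hn : ‖((h j, 0) : ℝ × ℝ)‖ = h j := by simp [Prod.norm_def, abs_of_pos hh, hh.le]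
    by_cases hb : p ∈ Metric.closedBall (0 : ℝ × ℝ) (B + 1)
    · rw [indicator_of_mem hb, Real.norm_eq_abs, abs_div, abs_of_pos hh, div_le_iff₀ hh]
      have h1 := hlip (p - (h j, 0)) p
      rw [sub_sub_cancel_left, norm_neg, hn] at h1
      have h2 := (K.chain j).abs_density_le hk p
      have h3 := (K.chain j).abs_crossing_le H hh hk p
      calc _ ≤ k * (C * h j) + C * (h j * g 0) := by
            refine (abs_add_le _ _).trans (add_le_add ?_ ?_)
            · rw [abs_mul]
              exact mul_le_mul h2 h1 (abs_nonneg _) hk.1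
            · rw [abs_mul]
              exact mul_le_mul (hder p) h3 (abs_nonneg _) hC
        _ = _ := by ring
    · rw [indicator_of_notMem hb]
      rw [mem_closedBall_zero_iff, not_le] at hb
      have h1 := hsupp p (by linarith)
      have h2 := hsupp (p - (h j, 0)) (by
        have := norm_sub_norm_le p (h j, 0)
        linarith)
      simp [h1.1, h1.2, h2.1]
  · exact (integrable_indicator_iff Metric.isClosed_closedBall.measurableSet).2
      (integrableOn_const (isCompact_closedBall _ _).measure_ne_top)
  · rcases le_or_gt t 0 with ht | ht
    · refine Eventually.of_forall fun x => ?_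
      have h1 : ∀ j, φ (t - h j, x) = 0 := fun j =>
        h0 _ (by simpa using ht.trans (K.h_pos j).le)
      simp [h1, h0 (t, x) ht, fderiv_eq_zero_of_nonpos h0 hp (p := (t, x)) ht]
    · have hd := ae_all_iff.2 fun j => ae_all_iff.2 fun n =>
        ((K.chain j).prim n).ae_differentiableAt
      filter_upwards [hd, (K.prim t).ae_differentiableAt,
        compl_mem_ae_iff.2 (measure_singleton (ζ t))] with x h1 h2 h3
      have l1 := K.tendsto_density H ht h3 h2.hasDerivAt h1 k
      have l2 := K.tendsto_crossing H ht h3 h2.hasDerivAt hk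
      have l3 := (l1.mul (K.tendsto_shift_div hφ t x)).add
        (l2.const_mul (fderiv ℝ φ (t, x) (0, 1)))
      convert l3 using 2 <;> ring

lemma integral_weak_nonpos (K : Approx R M L g h u ξ w ζ) (H : LegendreData R M f g P δ)
    (hk : k ∈ Icc 0 R) (hφ : ContDiff ℝ 1 φ) (hc : HasCompactSupport φ)
    (h0 : ∀ p : ℝ × ℝ, p.1 ≤ 0 → φ p = 0) (hp : ∀ p, 0 ≤ φ p) :
    ∫ p : ℝ × ℝ, (min (deriv (w p.1) p.2) k * fderiv ℝ φ p (1, 0)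
      + Real.sign (p.2 - ζ p.1) * f (min (deriv (w p.1) p.2) k) * fderiv ℝ φ p (0, 1)) ≤ 0 :=
  neg_nonneg.1 (ge_of_tendsto' (K.tendsto_integral H hk hφ hc h0 hp) fun j =>
    div_nonneg ((K.chain j).integral_nonneg H (K.h_pos j) hk hφ hc h0 hp) (K.h_pos j).le)

lemma integral_weak_eq_zero (K : Approx R M L g h u ξ w ζ) (H : LegendreData R M f g P δ)
    (hφ : ContDiff ℝ 1 φ) (hc : HasCompactSupport φ)
    (h0 : ∀ p : ℝ × ℝ, p.1 ≤ 0 → φ p = 0) (hp : ∀ p, 0 ≤ φ p) :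
    ∫ p : ℝ × ℝ, (min (deriv (w p.1) p.2) R * fderiv ℝ φ p (1, 0)
      + Real.sign (p.2 - ζ p.1) * f (min (deriv (w p.1) p.2) R) * fderiv ℝ φ p (0, 1)) = 0 := by
  have := K.tendsto_integral H H.R_mem hφ hc h0 hp
  simp only [fun j => (K.chain j).integral_eq_zero H (K.h_pos j) hφ hc h0, zero_div] at this
  exact neg_eq_zero.1 (tendsto_nhds_unique this tendsto_const_nhds)

end Approx

lemma abs_sign_le (x : ℝ) : |Real.sign x| ≤ 1 := by
  rcases Real.sign_apply_eq x with h | h | h <;> simp [h]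

lemma integral_sign_mul_deriv {ψ : ℝ → ℝ} (hψ : ContDiff ℝ 1 ψ) (hc : HasCompactSupport ψ)
    (a : ℝ) : ∫ x, Real.sign (x - a) * deriv ψ x = -2 * ψ a := by
  have hi : Integrable fun x => Real.sign (x - a) * deriv ψ x := by
    simp only [mul_comm (Real.sign _)]
    exact integrable_mul_of_abs_le (hψ.continuous_deriv le_rfl) hc.deriv
      (measurable_sign.comp (measurable_id.sub_const a)) fun x => abs_sign_le _
  rw [← integral_add_compl (measurableSet_Iic (a := a)) hi, compl_Iic]
  have h1 : ∫ x in Ioi a, Real.sign (x - a) * deriv ψ x = -ψ a := by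
    rw [← hc.integral_Ioi_deriv_eq hψ a]
    refine setIntegral_congr_fun measurableSet_Ioi fun x hx => ?_
    simp only [Real.sign_of_pos (sub_pos.2 hx), one_mul]
  have h2 : ∫ x in Iic a, Real.sign (x - a) * deriv ψ x = -ψ a := by
    rw [← hc.integral_Iic_deriv_eq hψ a, integral_Iic_eq_integral_Iio,
      integral_Iic_eq_integral_Iio, ← integral_neg]
    refine setIntegral_congr_fun measurableSet_Iio fun x hx => ?_
    simp only [Real.sign_of_neg (sub_neg.2 hx), neg_one_mul]
  rw [h1, h2]
  ring

lemma integral_fderiv_fst {φ : ℝ × ℝ → ℝ} (hφ : ContDiff ℝ 1 φ) (hc : HasCompactSupport φ) :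
    ∫ p : ℝ × ℝ, fderiv ℝ φ p (1, 0) = 0 := by
  have hi : Integrable fun p => fderiv ℝ φ p (1, 0) :=
    (continuous_partial hφ _).integrable_of_hasCompactSupport (hasCompactSupport_partial hc _)
  rw [Measure.volume_eq_prod] at hi ⊢
  rw [integral_prod_symm _ hi]
  refine integral_eq_zero_of_ae (Eventually.of_forall fun x => ?_)
  have hs : ContDiff ℝ 1 fun t => φ (t, x) := hφ.comp (contDiff_id.prodMk contDiff_const)
  have hsc := hasCompactSupport_slice_left hc x
  exact integral_eq_zero_of_hasDerivAt_of_integrable (fun t => hasDerivAt_slice_left hφ t x)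
    (((continuous_partial hφ _).comp (by fun_prop : Continuous fun t : ℝ => (t, x))
      ).integrable_of_hasCompactSupport (by
        have := hsc.deriv
        simpa only [funext fun t => (hasDerivAt_slice_left hφ t x).deriv] using! this))
    (hs.continuous.integrable_of_hasCompactSupport hsc)

namespace Approx

variable {R M L k : ℝ} {f g P δ : ℝ → ℝ} {h : ℕ → ℝ} {u : ℕ → ℕ → ℝ → ℝ} {ξ : ℕ → ℕ → ℝ}
  {w : ℝ → ℝ → ℝ} {ζ : ℝ → ℝ} {φ : ℝ × ℝ → ℝ}

lemma integrable_sign_mul (K : Approx R M L g h u ξ w ζ) (hφ : ContDiff ℝ 1 φ)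
    (hc : HasCompactSupport φ) :
    Integrable fun p : ℝ × ℝ => Real.sign (p.2 - ζ p.1) * fderiv ℝ φ p (0, 1) := by
  simp only [mul_comm (Real.sign _)]
  exact integrable_mul_of_abs_le (continuous_partial hφ _) (hasCompactSupport_partial hc _)
    K.measurable_sign_interface fun p => abs_sign_le _

lemma integral_sign_mul (K : Approx R M L g h u ξ w ζ) (hφ : ContDiff ℝ 1 φ)
    (hc : HasCompactSupport φ) :
    ∫ p : ℝ × ℝ, Real.sign (p.2 - ζ p.1) * fderiv ℝ φ p (0, 1) = -2 * ∫ t, φ (t, ζ t) := by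
  have hi := K.integrable_sign_mul hφ hc
  rw [Measure.volume_eq_prod] at hi ⊢
  rw [integral_prod _ hi, ← integral_const_mul]
  refine integral_congr_ae (Eventually.of_forall fun t => ?_)
  have hs : ContDiff ℝ 1 fun x => φ (t, x) := hφ.comp (contDiff_const.prodMk contDiff_id)
  have := integral_sign_mul_deriv hs (hasCompactSupport_slice hc t) (ζ t)
  simpa only [(hasDerivAt_slice hφ t _).deriv] using! this

lemma integrable_weak (K : Approx R M L g h u ξ w ζ) (H : LegendreData R M f g P δ)
    (hk : k ∈ Icc 0 R) (hφ : ContDiff ℝ 1 φ) (hc : HasCompactSupport φ) :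
    Integrable fun p : ℝ × ℝ => min (deriv (w p.1) p.2) k * fderiv ℝ φ p (1, 0)
      + Real.sign (p.2 - ζ p.1) * f (min (deriv (w p.1) p.2) k) * fderiv ℝ φ p (0, 1) := by
  obtain ⟨C, hC⟩ := isCompact_Icc.exists_bound_of_continuousOn H.f_cont
  simp only [mul_comm _ (fderiv ℝ φ _ _)]
  refine (integrable_mul_of_abs_le (continuous_partial hφ _) (hasCompactSupport_partial hc _)
    (K.measurable_min_density k) (C := k) fun p => ?_).add
    (integrable_mul_of_abs_le (continuous_partial hφ _) (hasCompactSupport_partial hc _)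
      (K.measurable_flux H hk) (C := 1 * C) fun p => ?_)
  · rw [abs_of_nonneg (K.density_mem hk p).1]
    exact (K.density_mem hk p).2
  · rw [abs_mul]
    exact mul_le_mul (abs_sign_le _)
      (hC _ ⟨(K.density_mem hk p).1, (K.density_mem hk p).2.trans hk.2⟩) (abs_nonneg _) one_pos.le

end Approx

lemma kruzhkov_split (v ζ : ℝ → ℝ) {R r : ℝ} (hr : r ≤ R) (k t x a b : ℝ) :
    |r - k| * a + hughesKruzhkov v ζ t x r k * b =
      (min r R * a + Real.sign (x - ζ t) * hughesFlux v (min r R) * b)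
      + (k * a + hughesFlux v k * (Real.sign (x - ζ t) * b))
      - 2 * (min r k * a + Real.sign (x - ζ t) * hughesFlux v (min r k) * b) := by
  simp only [hughesKruzhkov, hughesF, min_eq_left hr]
  rcases lt_trichotomy r k with h | h | h
  · rw [Real.sign_of_neg (sub_neg.2 h), min_eq_left h.le, abs_of_neg (sub_neg.2 h)]
    ring
  · simp [h]
    ring
  · rw [Real.sign_of_pos (sub_pos.2 h), min_eq_right h.le, abs_of_pos (sub_pos.2 h)]
    ring

lemma Approx.entropy {R M L k : ℝ} {v g P δ : ℝ → ℝ} {h : ℕ → ℝ} {u : ℕ → ℕ → ℝ → ℝ}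
    {ξ : ℕ → ℕ → ℝ} {w : ℝ → ℝ → ℝ} {ζ : ℝ → ℝ} (K : Approx R M L g h u ξ w ζ)
    (H : LegendreData R M (hughesFlux v) g P δ) (hk : k ∈ Icc 0 R) {φ : ℝ × ℝ → ℝ}
    (hφ : ContDiff ℝ 1 φ) (hc : HasCompactSupport φ)
    (h0 : ∀ p : ℝ × ℝ, p.1 ≤ 0 → φ p = 0) (hp : ∀ p, 0 ≤ φ p) :
    0 ≤ (∫ t in Ioi (0 : ℝ), ∫ x : ℝ,
          (|deriv (w t) x - k| * (fderiv ℝ φ (t, x)) (1, 0)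
            + hughesKruzhkov v ζ t x (deriv (w t) x) k * (fderiv ℝ φ (t, x)) (0, 1)))
        + 2 * ∫ t in Ioi (0 : ℝ), hughesFlux v k * φ (t, ζ t) := by
  have iR := K.integrable_weak H H.R_mem hφ hc
  have ik := K.integrable_weak H hk hφ hc
  have it : Integrable fun p => k * fderiv ℝ φ p (1, 0) :=
    ((continuous_partial hφ _).integrable_of_hasCompactSupport
      (hasCompactSupport_partial hc _)).const_mul k
  have ix := (K.integrable_sign_mul hφ hc).const_mul (hughesFlux v k)
  have hle : ∀ t x, deriv (w t) x ≤ R := fun t x => ((K.prim t).deriv_mem H.R_pos.le x).2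
  set G : ℝ × ℝ → ℝ := fun p => (min (deriv (w p.1) p.2) R * fderiv ℝ φ p (1, 0)
      + Real.sign (p.2 - ζ p.1) * hughesFlux v (min (deriv (w p.1) p.2) R) * fderiv ℝ φ p (0, 1))
    + (k * fderiv ℝ φ p (1, 0)
      + hughesFlux v k * (Real.sign (p.2 - ζ p.1) * fderiv ℝ φ p (0, 1)))
    - 2 * (min (deriv (w p.1) p.2) k * fderiv ℝ φ p (1, 0)
      + Real.sign (p.2 - ζ p.1) * hughesFlux v (min (deriv (w p.1) p.2) k)
        * fderiv ℝ φ p (0, 1)) with hG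
  have e1 : ∫ t in Ioi (0 : ℝ), ∫ x : ℝ,
      (|deriv (w t) x - k| * (fderiv ℝ φ (t, x)) (1, 0)
        + hughesKruzhkov v ζ t x (deriv (w t) x) k * (fderiv ℝ φ (t, x)) (0, 1)) =
      ∫ p, G p := by
    have hi : Integrable G := (iR.add (it.add ix)).sub (ik.const_mul 2)
    rw [Measure.volume_eq_prod] at hi ⊢
    rw [integral_prod _ hi, setIntegral_eq_integral_of_forall_compl_eq_zero]
    · simp only [fun t x => kruzhkov_split v ζ (hle t x), G]
    · intro t ht
      have ht' (x : ℝ) : fderiv ℝ φ (t, x) = 0 :=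
        fderiv_eq_zero_of_nonpos h0 hp (show t ≤ 0 from not_lt.1 ht)
      simp [ht']
  have e2 : ∫ t in Ioi (0 : ℝ), hughesFlux v k * φ (t, ζ t) =
      hughesFlux v k * ∫ t, φ (t, ζ t) := by
    rw [setIntegral_eq_integral_of_forall_compl_eq_zero, integral_const_mul]
    intro t ht
    rw [h0 (t, ζ t) (show t ≤ 0 from not_lt.1 ht), mul_zero]
  rw [e1, e2, hG, integral_sub (by exact iR.add (it.add ix)) (by exact ik.const_mul 2),
    integral_add iR (by exact it.add ix), integral_add it ix, integral_const_mul,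
    integral_const_mul, integral_const_mul, integral_fderiv_fst hφ hc, K.integral_sign_mul hφ hc,
    K.integral_weak_eq_zero H hφ hc h0 hp]
  linarith [K.integral_weak_nonpos H hk hφ hc h0 hp]

lemma integral_eq_of_eq_zero {r : ℝ → ℝ} {a b : ℝ}
    (hr : ∀ a b, IntervalIntegrable r volume a b) (h : ∀ y ∈ uIoc a b, r y = 0) :
    ∫ y in (0 : ℝ)..b, r y = ∫ y in (0 : ℝ)..a, r y := by
  rw [← intervalIntegral.integral_add_adjacent_intervals (hr 0 a) (hr a b),
    intervalIntegral.integral_zero_ae (Eventually.of_forall h), add_zero]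

theorem exists_isEntropySol {R α M : ℝ} {v g P δ : ℝ → ℝ}
    (H : LegendreData R M (hughesFlux v) g P δ) (hα : 0 ≤ α) {ρ₀ : ℝ → ℝ} (hmeas : Measurable ρ₀)
    (hrange : ∀ x ∈ Ioo (-1 : ℝ) 1, ρ₀ x ∈ Icc (0 : ℝ) R) :
    ∃ ρ : ℝ → ℝ → ℝ, ∃ ξ : ℝ → ℝ, IsEntropySol R v (fun r => 1 + α * r) ρ₀ ρ ξ := by
  set r : ℝ → ℝ := fun x => if x ∈ Ioo (-1 : ℝ) 1 then ρ₀ x else 0 with hr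
  have hR := H.R_pos.le
  have hrm : Measurable r := Measurable.ite measurableSet_Ioo hmeas measurable_const
  have hrR : ∀ x, r x ∈ Icc 0 R := fun x => by
    by_cases hx : x ∈ Ioo (-1 : ℝ) 1
    · simpa only [hr, if_pos hx] using hrange x hx
    · simpa only [hr, if_neg hx] using left_mem_Icc.2 hR
  have hloc := locallyIntegrable_of_mem_Icc hrm hrR
  have hri : ∀ a b, IntervalIntegrable r volume a b := fun a b =>
    (hloc.integrableOn_isCompact isCompact_uIcc).intervalIntegrable
  obtain ⟨L, h, u, ξ, w, hw0, hξ, K⟩ := H.exists_approx hα (prim_integral hrm hrR)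
  have hξ1 : ∀ j n, |ξ j n| ≤ 1 := fun j n => by
    have := (turn_spec hα ((K.chain j).prim n)).1
    rw [hξ]
    exact abs_le.2 ⟨this.1.le, this.2.le⟩
  have hb : ∀ x, 1 ≤ x → w 0 x = ∫ y in (0 : ℝ)..1, r y := fun x hx => by
    rw [hw0]
    refine integral_eq_of_eq_zero hri fun y hy => if_neg fun h => ?_
    rw [uIoc_of_le hx] at hy
    exact hy.1.not_gt h.2
  have hb' : ∀ x, x ≤ -1 → w 0 x = ∫ y in (0 : ℝ)..(-1), r y := fun x hx => by
    rw [hw0]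
    refine integral_eq_of_eq_zero hri fun y hy => if_neg fun h => ?_
    rw [uIoc_of_ge hx] at hy
    exact hy.2.not_gt h.1
  have hsupp : ∀ t, 0 ≤ t → ∀ x, 1 + t * M < |x| → deriv (w t) x = 0 :=
    fun t ht x hx => K.deriv_eq_zero H hξ1 hb hb' ht hx
  have hturn := fun t => turn_spec hα (K.prim t)
  refine ⟨fun t x => deriv (w t) x, fun t => turn α (w t), ?_⟩
  exact {
    meas := K.measurable_density
    range := fun t x _ => (K.prim t).deriv_mem hR x
    integrable := fun t ht => K.integrable_density hR (hsupp t ht)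
    timeCont := fun s hs => K.tendsto_integral_density H hsupp hs
    init := by
      filter_upwards [LocallyIntegrable.ae_hasDerivAt_integral hloc] with x hx
      rw [hw0]
      exact (hx 0).deriv
    xi_mem := fun t => (hturn t).1
    xi_lip := ⟨⟨L, K.L_nonneg⟩, LipschitzWith.lipschitzOnWith <| LipschitzWith.of_dist_le_mul
      fun s t => K.xi_abs_sub_le t s⟩
    balance := Eventually.of_forall fun t => (K.prim t).cost_balance (hturn t).1 (hturn t).2
    entropy := fun k hk φ hφ hc h0 hp =>
      K.entropy H hk (hφ.of_le (by exact_mod_cast le_top)) hc h0 hp }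

end Hughes

end Development

/-- Theorem 6 of Andreianov–Rosini–Stivaletta: with the linear cost
`c(ρ) = 1 + α·ρ`, `α ≥ 0`, and `v` satisfying (H2'), for every measurable initial
datum `ρ₀ : (−1,1) → [0,ρmax]` there exists a global-in-time entropy solution
of Hughes' model. -/
theorem hughes_linear_cost_existence
    (ρmax vmax α : ℝ) (hρmax : 0 < ρmax) (hα : 0 ≤ α)
    (v v' v'' : ℝ → ℝ) (hv : SpeedH2' ρmax vmax v v' v'')
    (ρ₀ : ℝ → ℝ) (hmeas : Measurable ρ₀)
    (hrange : ∀ x ∈ Ioo (-1 : ℝ) 1, ρ₀ x ∈ Icc (0 : ℝ) ρmax) :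
    ∃ ρ : ℝ → ℝ → ℝ, ∃ ξ : ℝ → ℝ,
      IsEntropySol ρmax v (fun r => 1 + α * r) ρ₀ ρ ξ := by
  obtain ⟨M, g, P, δ, H⟩ := Hughes.exists_legendreData hρmax hv
  exact Hughes.exists_isEntropySol H hα hmeas hrange

end
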